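/- Let F̄(x) = e^{−R(x)}, where R is regularly varying at infinity with index β ∈ (0,1), and assume F is strong subexponential (F ∈ S*). If β < 1/2 and in addition there exists c₁ < ∞ such that R(k) − R(k−1) ≤ c₁·R(k)/k for every integer k ≥ 1, then P{W_n > x} ~ F̄(mx) as x → ∞ uniformly in n ≥ 1, and P{W > x} ~ F̄(mx) as x → ∞. -/

import Mathlib

open MeasureTheory Filter ProbabilityTheory

structure RH (R : ℝ → ℝ) (β c1 : ℝ) : Prop where
  mono : Monotone R
  nonneg : ∀ x, 0 ≤ R x
  floor : ∀ x, 0 ≤ x → R x = R ((⌊x⌋₊ : ℕ) : ℝ)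
  b0 : 0 < β
  bh : β < 1 / 2
  rv : ∀ lam > (0 : ℝ), Tendsto (fun x => R (lam * x) / R x) atTop (nhds (lam ^ β))
  c0 : 0 ≤ c1
  incr : ∀ k : ℕ, 1 ≤ k → R k - R ((k : ℝ) - 1) ≤ c1 * R k / k

namespace RH
variable {R : ℝ → ℝ} {β c1 : ℝ}

theorem ev_pos (h : RH R β c1) : ∃ T : ℝ, 1 ≤ T ∧ ∀ x ≥ T, 0 < R x := by
  have h1 := h.rv 1 one_pos
  have h2 : ∀ᶠ x in atTop, 0 < R (1 * x) / R x := by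
    apply h1.eventually (lt_mem_nhds _)
    simp
  obtain ⟨T, hT⟩ := eventually_atTop.1 h2
  refine ⟨max T 1, le_max_right _ _, fun x hx => ?_⟩
  have := hT x (le_trans (le_max_left _ _) hx)
  rcases (h.nonneg x).lt_or_eq with h3 | h3
  · exact h3
  · rw [← h3] at this; simp at this

theorem mul_lt (h : RH R β c1) {lam a : ℝ} (hl : 0 < lam) (ha : lam ^ β < a) :
    ∃ T : ℝ, 1 ≤ T ∧ ∀ x ≥ T, R (lam * x) ≤ a * R x := by
  obtain ⟨T0, hT0, hp⟩ := h.ev_pos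
  obtain ⟨T, hT⟩ := eventually_atTop.1 ((h.rv lam hl).eventually (gt_mem_nhds ha))
  refine ⟨max T T0, le_trans hT0 (le_max_right _ _), fun x hx => ?_⟩
  have h1 := hT x (le_trans (le_max_left _ _) hx)
  have h2 := hp x (le_trans (le_max_right _ _) hx)
  rw [div_lt_iff₀ h2] at h1
  exact h1.le

theorem lt_mul (h : RH R β c1) {lam a : ℝ} (hl : 0 < lam) (ha : a < lam ^ β) :
    ∃ T : ℝ, 1 ≤ T ∧ ∀ x ≥ T, a * R x ≤ R (lam * x) := by
  obtain ⟨T0, hT0, hp⟩ := h.ev_pos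
  obtain ⟨T, hT⟩ := eventually_atTop.1 ((h.rv lam hl).eventually (lt_mem_nhds ha))
  refine ⟨max T T0, le_trans hT0 (le_max_right _ _), fun x hx => ?_⟩
  have h1 := hT x (le_trans (le_max_left _ _) hx)
  have h2 := hp x (le_trans (le_max_right _ _) hx)
  rw [lt_div_iff₀ h2] at h1
  exact h1.le

theorem potter_up (h : RH R β c1) {b η : ℝ} (hb : β < b) (hη : 0 < η) :
    ∃ T : ℝ, 1 ≤ T ∧ ∀ t ≥ T, ∀ u ≥ t, R u ≤ (1 + η) * (u / t) ^ b * R t := by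
  have hb0 : 0 < b := h.b0.trans hb
  set lam : ℝ := (1 + η) ^ (1 / b) with hlam
  have hl1 : 1 < lam := Real.one_lt_rpow (by linarith) (by positivity)
  have hlb : lam ^ b = 1 + η := by
    rw [hlam, ← Real.rpow_mul (by linarith)]
    field_simp
    simp
  obtain ⟨T, hT1, hT⟩ := h.mul_lt (lam := lam) (a := lam ^ b) (by linarith)
    (Real.rpow_lt_rpow_of_exponent_lt hl1 hb)
  refine ⟨T, hT1, fun t ht u hu => ?_⟩
  have ht0 : 0 < t := by linarith
  have hpow : ∀ k : ℕ, R (lam ^ k * t) ≤ (lam ^ b) ^ k * R t := by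
    intro k
    induction k with
    | zero => simp
    | succ k ih =>
      have h1 : T ≤ lam ^ k * t := by
        have := one_le_pow₀ hl1.le (n := k)
        nlinarith
      have h2 := hT _ h1
      calc R (lam ^ (k + 1) * t) = R (lam * (lam ^ k * t)) := by ring_nf
        _ ≤ _ := h2
        _ ≤ lam ^ b * ((lam ^ b) ^ k * R t) := by gcongr
        _ = _ := by ring
  obtain ⟨k, hk1, hk2⟩ := exists_nat_pow_near (x := u / t) (y := lam) (by rw [le_div_iff₀ ht0]; linarith) hl1
  have h3 : u ≤ lam ^ (k + 1) * t := by
    rw [div_lt_iff₀ ht0] at hk2; exact hk2.le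
  calc R u ≤ R (lam ^ (k + 1) * t) := h.mono h3
    _ ≤ (lam ^ b) ^ (k + 1) * R t := hpow _
    _ = (1 + η) * (lam ^ k) ^ b * R t := by
        rw [pow_succ, hlb]
        have : (lam ^ k) ^ b = (1 + η) ^ k := by
          rw [← Real.rpow_natCast, ← Real.rpow_mul (by linarith), mul_comm, Real.rpow_mul (by linarith), hlb,
            Real.rpow_natCast]
        rw [this]; ring
    _ ≤ _ := by
        have := h.nonneg t
        gcongr

theorem potter_low (h : RH R β c1) {b : ℝ} (hb0 : 0 < b) (hb : b < β) :
    ∃ T : ℝ, 1 ≤ T ∧ ∀ t ≥ T, ∀ u ≥ t, 1 / 2 * (u / t) ^ b * R t ≤ R u := by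
  set lam : ℝ := (2 : ℝ) ^ (1 / b) with hlam
  have hl1 : 1 < lam := Real.one_lt_rpow (by norm_num) (by positivity)
  have hlb : lam ^ b = 2 := by
    rw [hlam, ← Real.rpow_mul (by norm_num)]
    field_simp
    simp
  obtain ⟨T, hT1, hT⟩ := h.lt_mul (lam := lam) (a := lam ^ b) (by linarith)
    (Real.rpow_lt_rpow_of_exponent_lt hl1 hb)
  refine ⟨T, hT1, fun t ht u hu => ?_⟩
  have ht0 : 0 < t := by linarith
  have hpow : ∀ k : ℕ, (lam ^ b) ^ k * R t ≤ R (lam ^ k * t) := by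
    intro k
    induction k with
    | zero => simp
    | succ k ih =>
      have h1 : T ≤ lam ^ k * t := by
        have := one_le_pow₀ hl1.le (n := k)
        nlinarith
      have h2 := hT _ h1
      calc (lam ^ b) ^ (k + 1) * R t = lam ^ b * ((lam ^ b) ^ k * R t) := by ring
        _ ≤ lam ^ b * R (lam ^ k * t) := by gcongr
        _ ≤ _ := h2
        _ = R (lam ^ (k + 1) * t) := by ring_nf
  obtain ⟨k, hk1, hk2⟩ := exists_nat_pow_near (x := u / t) (y := lam) (by rw [le_div_iff₀ ht0]; linarith) hl1
  have h3 : lam ^ k * t ≤ u := by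
    rw [le_div_iff₀ ht0] at hk1; exact hk1
  have hut : 0 ≤ u / t := div_nonneg (by linarith) ht0.le
  calc 1 / 2 * (u / t) ^ b * R t ≤ 1 / 2 * (lam ^ (k + 1)) ^ b * R t := by
        have := h.nonneg t
        gcongr
    _ = (lam ^ b) ^ k * R t := by
        have : (lam ^ (k + 1)) ^ b = 2 ^ (k + 1) := by
          rw [← Real.rpow_natCast, ← Real.rpow_mul (by linarith), mul_comm, Real.rpow_mul (by linarith), hlb,
            Real.rpow_natCast]
        rw [this, hlb]; ring
    _ ≤ R (lam ^ k * t) := hpow _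
    _ ≤ _ := h.mono h3

/-- quasi-decreasing `R t / t` -/
theorem qd (h : RH R β c1) {η : ℝ} (hη : 0 < η) :
    ∃ T : ℝ, 1 ≤ T ∧ ∀ t ≥ T, ∀ u ≥ t, R u * t ≤ (1 + η) * R t * u := by
  obtain ⟨T, hT1, hT⟩ := h.potter_up (b := 1) (by have := h.bh; linarith) hη
  refine ⟨T, hT1, fun t ht u hu => ?_⟩
  have := hT t ht u hu
  have ht0 : 0 < t := by linarith
  rw [Real.rpow_one] at this
  calc R u * t ≤ ((1 + η) * (u / t) * R t) * t := by gcongr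
    _ = _ := by field_simp

/-- sublinear growth with power less than one half -/
theorem half (h : RH R β c1) : ∃ e : ℝ, 0 < e ∧ e < 1 / 8 ∧ ∃ T : ℝ, 1 ≤ T ∧ ∀ x ≥ T, R x ≤ x ^ (1 / 2 - 2 * e) := by
  have hb := h.bh
  have hb0 := h.b0
  set e : ℝ := (1 / 2 - β) / 6 with he
  obtain ⟨T, hT1, hT⟩ := h.potter_up (b := 1 / 2 - 3 * e) (η := 1) (by rw [he]; linarith) one_pos
  have he0 : 0 < e := by rw [he]; linarith
  refine ⟨e, he0, by rw [he]; linarith, ?_⟩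
  have h1 : Tendsto (fun x : ℝ => x ^ e) atTop atTop := tendsto_rpow_atTop he0
  obtain ⟨T2, hT2⟩ := eventually_atTop.1 (h1.eventually_ge_atTop (2 * (1 / T) ^ (1 / 2 - 3 * e) * R T))
  refine ⟨max T T2, le_trans hT1 (le_max_left _ _), fun x hx => ?_⟩
  have hxT := le_trans (le_max_left _ _) hx
  have h2 := hT T le_rfl x hxT
  have h3 := hT2 x (le_trans (le_max_right _ _) hx)
  have hx0 : 0 < x := by linarith
  calc R x ≤ (1 + 1) * (x / T) ^ (1 / 2 - 3 * e) * R T := h2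
    _ = (2 * (1 / T) ^ (1 / 2 - 3 * e) * R T) * x ^ (1 / 2 - 3 * e) := by
      rw [show x / T = x * (1 / T) by ring, Real.mul_rpow hx0.le (by positivity)]; ring
    _ ≤ x ^ e * x ^ (1 / 2 - 3 * e) := by gcongr
    _ = _ := by rw [← Real.rpow_add hx0]; ring_nf

theorem lowpow (h : RH R β c1) : ∃ g : ℝ, 0 < g ∧ ∃ T : ℝ, 1 ≤ T ∧ ∀ x ≥ T, x ^ g ≤ R x := by
  have hb0 := h.b0
  obtain ⟨T, hT1, hT⟩ := h.potter_low (b := β / 2) (by linarith) (by linarith)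
  obtain ⟨T0, hT01, hT0⟩ := h.ev_pos
  refine ⟨β / 4, by linarith, ?_⟩
  set T3 := max T T0 with hT3
  have hT3p : 0 < T3 := lt_of_lt_of_le (by linarith) (le_max_left _ _)
  have hRp := hT0 T3 (le_max_right _ _)
  have h1 : Tendsto (fun x : ℝ => x ^ (β / 4)) atTop atTop := tendsto_rpow_atTop (by linarith)
  set q := 1 / 2 * (1 / T3) ^ (β / 2) * R T3 with hq
  have hqp : 0 < q := by positivity
  obtain ⟨T2, hT2⟩ := eventually_atTop.1 (h1.eventually_ge_atTop (1 / q))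
  refine ⟨max T3 T2, le_trans (le_trans hT1 (le_max_left _ _)) (le_max_left _ _), fun x hx => ?_⟩
  have hxT := le_trans (le_max_left _ _) hx
  have h2 := hT T3 (le_max_left _ _) x hxT
  have h3 := hT2 x (le_trans (le_max_right _ _) hx)
  have hx0 : 0 < x := by linarith
  rw [div_le_iff₀ hqp] at h3
  calc x ^ (β / 4) = 1 * x ^ (β / 4) := by ring
    _ ≤ (x ^ (β / 4) * q) * x ^ (β / 4) := by gcongr
    _ = q * x ^ (β / 2) := by
      rw [show β / 2 = β / 4 + β / 4 by ring, Real.rpow_add hx0]; ring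
    _ = 1 / 2 * (x / T3) ^ (β / 2) * R T3 := by
      rw [show x / T3 = x * (1 / T3) by ring, Real.mul_rpow hx0.le (by positivity), hq]; ring
    _ ≤ _ := h2

theorem incr_nat (h : RH R β c1) (a d : ℕ) :
    R ((a + d : ℕ) : ℝ) - R (a : ℝ) ≤ d * (c1 * R ((a + d : ℕ) : ℝ) / (a + 1)) := by
  have hc := h.c0
  induction d with
  | zero => simp
  | succ d ih =>
    have h1 := h.incr (a + (d + 1)) (by omega)
    have e1 : (((a + (d + 1) : ℕ) : ℝ) - 1) = ((a + d : ℕ) : ℝ) := by push_cast; ring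
    rw [e1] at h1
    have hm : R ((a + d : ℕ) : ℝ) ≤ R ((a + (d + 1) : ℕ) : ℝ) := h.mono (by push_cast; linarith)
    have hn := h.nonneg ((a + (d + 1) : ℕ) : ℝ)
    have h2 : c1 * R ((a + (d + 1) : ℕ) : ℝ) / ((a + (d + 1) : ℕ) : ℝ) ≤ c1 * R ((a + (d + 1) : ℕ) : ℝ) / (a + 1) := by
      gcongr
      push_cast
      have : (0 : ℝ) ≤ d := by positivity
      linarith
    have h3 : d * (c1 * R ((a + d : ℕ) : ℝ) / (a + 1)) ≤ d * (c1 * R ((a + (d + 1) : ℕ) : ℝ) / (a + 1)) := by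
      gcongr
    push_cast at *
    linarith

theorem incr_real (h : RH R β c1) : ∃ C : ℝ, 0 < C ∧ ∀ X > 0, ∀ u, 0 ≤ u → u ≤ X →
    R X - R (X - u) ≤ C * ((u + 1) * R X / X) := by
  have hc := h.c0
  refine ⟨2 * c1 + 2, by linarith, fun X hX u hu huX => ?_⟩
  have hn := h.nonneg X
  have hn' := h.nonneg (X - u)
  by_cases hc2 : X / 2 < u
  · have : R X ≤ 2 * ((u + 1) * R X / X) := by
      rw [← mul_div_assoc, le_div_iff₀ hX]; nlinarith
    have h2 : 0 ≤ (u + 1) * R X / X := by positivity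
    nlinarith
  · push Not at hc2
    set a := ⌊X - u⌋₊ with ha
    have hab : a ≤ ⌊X⌋₊ := Nat.floor_le_floor (by linarith)
    obtain ⟨d, hd⟩ := Nat.exists_eq_add_of_le hab
    have h1 := h.incr_nat a d
    rw [← hd, ← h.floor X hX.le, ha, ← h.floor (X - u) (by linarith), ← ha] at h1
    have h2 : X - u < a + 1 := Nat.lt_floor_add_one _
    have h3 : (d : ℝ) ≤ u + 1 := by
      have : ((⌊X⌋₊ : ℕ) : ℝ) ≤ X := Nat.floor_le hX.le
      rw [hd] at this; push_cast at this; linarith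
    calc R X - R (X - u) ≤ d * (c1 * R X / (a + 1)) := h1
      _ ≤ (u + 1) * (c1 * R X / (X / 2)) := by
        gcongr; linarith
      _ = 2 * c1 * ((u + 1) * R X / X) := by field_simp
      _ ≤ _ := by
        gcongr; linarith

theorem step_bdd (h : RH R β c1) : ∃ C : ℝ, 0 < C ∧ ∀ x, 0 ≤ x → R (x + 1) ≤ R x + C := by
  obtain ⟨C, hC, hi⟩ := h.incr_real
  obtain ⟨e, he, he8, T, hT1, hT⟩ := h.half
  refine ⟨2 * C + R (T + 1), by have := h.nonneg (T + 1); linarith, fun x hx => ?_⟩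
  have hn := h.nonneg x
  have hn' := h.nonneg (T + 1)
  by_cases hxT : x + 1 ≤ T
  · have := h.mono (show x + 1 ≤ T + 1 by linarith)
    linarith
  · push Not at hxT
    have h1 := hi (x + 1) (by linarith) 1 (by norm_num) (by linarith)
    have h2 := hT (x + 1) hxT.le
    have h3 : (x + 1) ^ (1 / 2 - 2 * e) ≤ (x + 1) ^ (1 : ℝ) :=
      Real.rpow_le_rpow_of_exponent_le (by linarith) (by linarith)
    rw [Real.rpow_one] at h3
    have h4 : (1 + 1) * R (x + 1) / (x + 1) ≤ 2 := by
      rw [div_le_iff₀ (by linarith)]; linarith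
    rw [add_sub_cancel_right] at h1
    nlinarith

theorem sub_add (h : RH R β c1) {b : ℝ} (hb : 1 < b) :
    ∃ T : ℝ, 1 ≤ T ∧ ∀ u ≥ T, ∀ X ≥ u, R X - R (X - u) ≤ b * R u := by
  obtain ⟨C, hC, hi⟩ := h.incr_real
  obtain ⟨T1, hT11, hT1⟩ := h.potter_up (b := 1 / 2) (η := 1) h.bh one_pos
  -- delta: 4 C δ^{1/2} ≤ 1
  set δ : ℝ := (1 / (4 * C)) ^ 2 ⊓ 1 with hδ
  have hδ0 : 0 < δ := by rw [hδ]; positivity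
  have hδ1 : δ ≤ 1 := inf_le_right
  set η : ℝ := min 1 ((b - 1) * δ / 8) with hη
  have hη0 : 0 < η := by
    rw [hη]; apply lt_min one_pos; have : 0 < b - 1 := by linarith
    positivity
  have hη1 : η ≤ 1 := min_le_left _ _
  have hη2 : η ≤ (b - 1) * δ / 8 := min_le_right _ _
  obtain ⟨T2, hT21, hT2⟩ := h.qd hη0
  set T := max (max T1 T2) (8 * T2 / (b - 1)) with hT
  have hTT1 : T1 ≤ T := le_trans (le_max_left _ _) (le_max_left _ _)
  have hTT2 : T2 ≤ T := le_trans (le_max_right _ _) (le_max_left _ _)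
  have hTT3 : 8 * T2 / (b - 1) ≤ T := le_max_right _ _
  refine ⟨T, hT11.trans hTT1, fun u hu X hX => ?_⟩
  have hu0 : 0 < u := by linarith
  have hX0 : 0 < X := by linarith
  have hRu := h.nonneg u
  have hRX := h.nonneg X
  have hRXu := h.nonneg (X - u)
  have hbp : 0 < b - 1 := by linarith
  by_cases hc : δ * X ≤ u
  · have h2 := hT2 u (by linarith) X hX
    by_cases hc2 : T2 ≤ X - u
    · have h3 := hT2 (X - u) hc2 X (by linarith)
      have h4 : R X ≤ (1 + η) * (R (X - u) + R u) := by
        have : R X * X ≤ ((1 + η) * (R (X - u) + R u)) * X := by nlinarith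
        exact le_of_mul_le_mul_right this hX0
      -- R (X-u) ≤ R X ≤ 2 R u / δ
      have h5 : R X * δ ≤ 2 * R u := by
        have : R X * u ≤ 2 * R u * X := by
          refine h2.trans ?_
          gcongr
          linarith
        have h6 : R X * (δ * X) ≤ 2 * R u * X := le_trans (by gcongr) this
        have : (R X * δ) * X ≤ (2 * R u) * X := by linarith
        exact le_of_mul_le_mul_right this hX0
      have h7 : R (X - u) ≤ R X := h.mono (by linarith)
      have h8 : η * R (X - u) ≤ (b - 1) / 4 * R u := by
        calc η * R (X - u) ≤ ((b - 1) * δ / 8) * R X := by gcongr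
          _ = (b - 1) / 8 * (R X * δ) := by ring
          _ ≤ (b - 1) / 8 * (2 * R u) := by gcongr
          _ = _ := by ring
      have h9 : η ≤ (b - 1) / 8 := hη2.trans (by
        have := mul_le_mul_of_nonneg_left hδ1 hbp.le
        linarith)
      nlinarith
    · push Not at hc2
      -- X ≤ u + T2
      have h9 : η ≤ (b - 1) / 8 := hη2.trans (by
        have := mul_le_mul_of_nonneg_left hδ1 hbp.le
        linarith)
      have h10 : T2 ≤ (b - 1) / 8 * u := by
        have := hTT3.trans hu
        rw [div_le_iff₀ hbp] at this
        linarith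
      have h11 : R X * u ≤ ((1 + η) * (1 + (b - 1) / 8) * R u) * u := by
        refine h2.trans ?_
        have : X ≤ (1 + (b - 1) / 8) * u := by linarith
        calc (1 + η) * R u * X ≤ (1 + η) * R u * ((1 + (b - 1) / 8) * u) := by gcongr
          _ = _ := by ring
      have h12 := le_of_mul_le_mul_right h11 hu0
      have h13 : (1 + η) * (1 + (b - 1) / 8) ≤ b := by nlinarith
      nlinarith
  · push Not at hc
    have h1 := hi X hX0 u hu0.le hX
    have h2 := hT1 u (by linarith) X hX
    have h3 : C * ((u + 1) * R X / X) ≤ R u := by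
      have hr : 0 < X / u := by positivity
      have hsq : (X / u) ^ (1 / 2 : ℝ) * (X / u) ^ (1 / 2 : ℝ) = X / u := by
        rw [← Real.rpow_add hr]; norm_num
      set r := (X / u) ^ (1 / 2 : ℝ) with hrdef
      have hr0 : 0 < r := by positivity
      have hrC : 4 * C ≤ r := by
        have h4 : u ≤ (1 / (4 * C)) ^ 2 * X := hc.le.trans (by gcongr; exact inf_le_left)
        have h5 : (4 * C) ^ 2 ≤ r ^ 2 := by
          rw [pow_two r, hsq, le_div_iff₀ hu0]
          calc (4 * C) ^ 2 * u ≤ (4 * C) ^ 2 * ((1 / (4 * C)) ^ 2 * X) := by gcongr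
            _ = X := by field_simp
        exact le_of_sq_le_sq h5 hr0.le
      have hXe : X = r * r * u := by rw [hsq]; field_simp
      calc C * ((u + 1) * R X / X) ≤ C * ((u + u) * ((1 + 1) * r * R u) / X) := by
            gcongr; linarith
        _ = (4 * C) / r * R u := by
            rw [hXe]; field_simp; ring
        _ ≤ 1 * R u := by
            gcongr; rw [div_le_one hr0]; exact hrC
        _ = R u := one_mul _
    nlinarith

end RH

open MeasureTheory Filter ProbabilityTheory

open scoped ENNReal

noncomputable def gwE (q : PMF ℕ) (f : ℕ → ℝ≥0∞) : ℝ≥0∞ := ∑' a, q a * f a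

noncomputable def gwT (q : PMF ℕ) (t : ℝ) : ℝ≥0∞ := gwE q (fun a => if t < (a : ℝ) then 1 else 0)

noncomputable def gwPw (q : PMF ℕ) : ℕ → PMF ℕ
  | 0 => PMF.pure 0
  | k + 1 => q.bind fun a => (gwPw q k).bind fun b => PMF.pure (a + b)

/-- law after n generations starting from k individuals -/
noncomputable def gwK (p : PMF ℕ) : ℕ → ℕ → PMF ℕ
  | 0, k => PMF.pure k
  | n + 1, k => (gwK p n k).bind (gwPw p)

theorem gwE_bind (q : PMF ℕ) (g : ℕ → PMF ℕ) (f : ℕ → ℝ≥0∞) :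
    gwE (q.bind g) f = gwE q (fun a => gwE (g a) f) := by
  unfold gwE
  simp only [PMF.bind_apply, ← ENNReal.tsum_mul_right, ← ENNReal.tsum_mul_left]
  rw [ENNReal.tsum_comm]
  simp only [mul_assoc]

theorem gwE_pure (k : ℕ) (f : ℕ → ℝ≥0∞) : gwE (PMF.pure k) f = f k := by
  unfold gwE
  rw [tsum_eq_single k]
  · simp
  · intro b hb; simp [PMF.pure_apply, hb]

theorem gwE_mono (q : PMF ℕ) {f g : ℕ → ℝ≥0∞} (h : ∀ a, f a ≤ g a) : gwE q f ≤ gwE q g :=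
  ENNReal.tsum_le_tsum fun a => by gcongr; exact h a

theorem gwE_add (q : PMF ℕ) (f g : ℕ → ℝ≥0∞) :
    gwE q (fun a => f a + g a) = gwE q f + gwE q g := by
  unfold gwE; simp only [mul_add]; exact ENNReal.tsum_add

theorem gwE_mul_left (q : PMF ℕ) (c : ℝ≥0∞) (f : ℕ → ℝ≥0∞) :
    gwE q (fun a => c * f a) = c * gwE q f := by
  unfold gwE; rw [← ENNReal.tsum_mul_left]; congr 1; ext a; ring

theorem gwE_mul_right (q : PMF ℕ) (c : ℝ≥0∞) (f : ℕ → ℝ≥0∞) :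
    gwE q (fun a => f a * c) = gwE q f * c := by
  unfold gwE; rw [← ENNReal.tsum_mul_right]; congr 1; ext a; ring

theorem gwE_const (q : PMF ℕ) (c : ℝ≥0∞) : gwE q (fun _ => c) = c := by
  unfold gwE; rw [ENNReal.tsum_mul_right, PMF.tsum_coe, one_mul]

theorem gwE_tsum (q : PMF ℕ) (f : ℕ → ℕ → ℝ≥0∞) :
    gwE q (fun a => ∑' j, f j a) = ∑' j, gwE q (f j) := by
  unfold gwE; simp only [← ENNReal.tsum_mul_left]; exact ENNReal.tsum_comm

theorem gwT_le_one (q : PMF ℕ) (t : ℝ) : gwT q t ≤ 1 := by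
  rw [← gwE_const q 1]; exact gwE_mono q fun a => by split_ifs <;> simp

theorem gwT_anti (q : PMF ℕ) {s t : ℝ} (h : s ≤ t) : gwT q t ≤ gwT q s := by
  refine gwE_mono q fun a => ?_
  by_cases h1 : t < (a : ℝ)
  · rw [if_pos h1, if_pos (h.trans_lt h1)]
  · rw [if_neg h1]; exact bot_le

theorem gwE_pw_succ (q : PMF ℕ) (k : ℕ) (f : ℕ → ℝ≥0∞) :
    gwE (gwPw q (k + 1)) f = gwE q (fun a => gwE (gwPw q k) (fun b => f (a + b))) := by
  rw [gwPw, gwE_bind]; congr 1; ext a; rw [gwE_bind]; simp only [gwE_pure]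

theorem gwPw_add (q : PMF ℕ) (a b : ℕ) :
    gwPw q (a + b) = (gwPw q a).bind fun x => (gwPw q b).bind fun y => PMF.pure (x + y) := by
  induction a with
  | zero => simp [gwPw, PMF.bind_pure]
  | succ a ih =>
    rw [Nat.succ_add, gwPw, ih, gwPw]
    simp only [PMF.bind_bind, PMF.pure_bind, add_assoc]

theorem gwPw_one (q : PMF ℕ) : gwPw q 1 = q := by
  simp [gwPw, PMF.bind_pure]

theorem gwK_branch (p : PMF ℕ) (n k : ℕ) : gwK p n k = gwPw (gwK p n 1) k := by
  have hadd : ∀ n a b, gwK p n (a + b) =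
      (gwK p n a).bind fun x => (gwK p n b).bind fun y => PMF.pure (x + y) := by
    intro n
    induction n with
    | zero => intro a b; simp [gwK]
    | succ n ih =>
      intro a b
      simp only [gwK]
      rw [ih]
      simp only [PMF.bind_bind, PMF.pure_bind, gwPw_add]
      congr 1; ext1 x
      rw [PMF.bind_comm]
  have h0 : ∀ n, gwK p n 0 = PMF.pure 0 := by
    intro n
    induction n with
    | zero => rfl
    | succ n ih => simp [gwK, ih, gwPw]
  induction k with
  | zero => rw [h0]; rfl
  | succ k ih => rw [add_comm, hadd, ih, add_comm, gwPw]

theorem gwK_succ_left (p : PMF ℕ) (n k : ℕ) : gwK p (n + 1) k = (gwPw p k).bind (gwK p n) := by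
  induction n generalizing k with
  | zero => simp [gwK, PMF.bind_pure]
  | succ n ih =>
    rw [gwK, ih, PMF.bind_bind]; rfl

theorem gwK_succ_branch (p : PMF ℕ) (n : ℕ) : gwK p (n + 1) 1 = p.bind (gwPw (gwK p n 1)) := by
  rw [gwK_succ_left, gwPw_one]; congr 1; ext1 k; exact gwK_branch p n k

theorem gw_nagaev (q : PMF ℕ) (s u : ℝ) (hs : 0 ≤ s) (k : ℕ) (a : ℝ) :
    gwT (gwPw q k) a ≤ k * gwT q u + ENNReal.ofReal (Real.exp (-s * a)) *
      (gwE q (fun y => if (y : ℝ) ≤ u then ENNReal.ofReal (Real.exp (s * y)) else 0)) ^ k := by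
  set M := gwE q (fun y => if (y : ℝ) ≤ u then ENNReal.ofReal (Real.exp (s * y)) else 0) with hM
  induction k generalizing a with
  | zero =>
    simp only [gwT, gwPw, gwE_pure, pow_zero, mul_one]
    split_ifs with h
    · rw [← ENNReal.ofReal_one]
      refine le_trans (ENNReal.ofReal_le_ofReal ?_) le_add_self
      rw [Real.one_le_exp_iff]; simp at h; nlinarith
    · simp
  | succ k ih =>
    have key : ∀ y : ℕ, gwE (gwPw q k) (fun b => if a < ((y + b : ℕ) : ℝ) then 1 else 0) ≤
        ((if u < (y : ℝ) then 1 else 0) + k * gwT q u) + (ENNReal.ofReal (Real.exp (-s * a)) * M ^ k) *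
          (if (y : ℝ) ≤ u then ENNReal.ofReal (Real.exp (s * y)) else 0) := by
      intro y
      have e1 : gwE (gwPw q k) (fun b => if a < ((y + b : ℕ) : ℝ) then 1 else 0) = gwT (gwPw q k) (a - y) := by
        unfold gwT
        congr 1; ext b; push_cast; simp only [sub_lt_iff_lt_add, add_comm]
      rw [e1]
      by_cases hy : u < (y : ℝ)
      · rw [if_pos hy, if_neg (not_le.2 hy), mul_zero, add_zero]
        exact (gwT_le_one _ _).trans le_self_add
      · rw [if_neg hy, if_pos (not_lt.1 hy), zero_add]
        refine (ih (a - y)).trans (le_of_eq ?_)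
        congr 1
        rw [mul_right_comm, ← ENNReal.ofReal_mul (Real.exp_pos _).le, ← Real.exp_add]
        congr 3; ring
    unfold gwT at key ⊢
    rw [gwE_pw_succ]
    refine (gwE_mono q key).trans (le_of_eq ?_)
    rw [gwE_add, gwE_add, gwE_const, gwE_mul_left, ← hM]
    push_cast; ring

theorem gw_lower (q : PMF ℕ) (s : ℝ) (hs : 0 ≤ s) (k : ℕ) (a : ℝ) :
    gwE (gwPw q k) (fun b => if (b : ℝ) ≤ a then 1 else 0) ≤ ENNReal.ofReal (Real.exp (s * a)) *
      (gwE q (fun y => ENNReal.ofReal (Real.exp (-s * y)))) ^ k := by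
  induction k generalizing a with
  | zero =>
    simp only [gwPw, gwE_pure, pow_zero, mul_one]
    split_ifs with h
    · rw [← ENNReal.ofReal_one]
      apply ENNReal.ofReal_le_ofReal
      rw [Real.one_le_exp_iff]; simp at h; positivity
    · simp
  | succ k ih =>
    rw [gwE_pw_succ, pow_succ', ← mul_assoc, ← gwE_mul_left, ← gwE_mul_right]
    refine gwE_mono q fun y => ?_
    have := ih (a - y)
    calc gwE (gwPw q k) (fun b => if ((y + b : ℕ) : ℝ) ≤ a then 1 else 0)
        = gwE (gwPw q k) (fun b => if (b : ℝ) ≤ a - y then 1 else 0) := by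
          congr 1; ext b; push_cast; simp only [le_sub_iff_add_le, add_comm]
      _ ≤ _ := this
      _ = _ := by
        congr 1
        rw [← ENNReal.ofReal_mul (Real.exp_pos _).le, ← Real.exp_add]
        congr 2; ring

theorem gwE_pw_mean (q : PMF ℕ) (k : ℕ) :
    gwE (gwPw q k) (fun a => (a : ℝ≥0∞)) = k * gwE q (fun a => (a : ℝ≥0∞)) := by
  induction k with
  | zero => simp [gwPw, gwE_pure]
  | succ k ih =>
    rw [gwE_pw_succ]
    simp only [Nat.cast_add, gwE_add, gwE_const, ih]
    push_cast; ring

theorem gwK_mean (p : PMF ℕ) (n : ℕ) :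
    gwE (gwK p n 1) (fun a => (a : ℝ≥0∞)) = (gwE p (fun a => (a : ℝ≥0∞))) ^ n := by
  induction n with
  | zero => simp [gwK, gwE_pure]
  | succ n ih =>
    rw [gwK, gwE_bind]
    simp only [gwE_pw_mean, gwE_mul_right, ih, pow_succ]

open MeasureTheory Filter ProbabilityTheory

open scoped ENNReal

theorem gw_exp_up {z : ℝ} (hz : 0 ≤ z) : Real.exp z ≤ 1 + z + z ^ 2 * Real.exp z := by
  have h1 : Real.exp z - 1 ≤ z * Real.exp z := by
    have := Real.add_one_le_exp (-z)
    have h2 : Real.exp z * Real.exp (-z) = 1 := by rw [← Real.exp_add]; simp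
    have h3 := Real.exp_pos z
    nlinarith
  nlinarith

theorem gw_exp_down {z : ℝ} (hz : 0 ≤ z) : Real.exp (-z) + z ≤ 1 + z ^ 2 := by
  have h1 := Real.add_one_le_exp z
  have h2 : Real.exp z * Real.exp (-z) = 1 := by rw [← Real.exp_add]; simp
  have h3 := Real.exp_pos (-z)
  have h4 : (1 + z) * Real.exp (-z) ≤ 1 := by nlinarith
  have h5 : (1 + z) * Real.exp (-z) ≤ (1 + z) * (1 + z ^ 2 - z) := by
    have : 0 ≤ z ^ 3 := by positivity
    nlinarith
  have := le_of_mul_le_mul_left h5 (by linarith)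
  linarith

namespace RH
variable {R : ℝ → ℝ} {β c1 : ℝ}

theorem expdec (h : RH R β c1) {κ : ℝ} (hκ : 0 < κ) (A : ℕ) :
    ∃ T : ℝ, 1 ≤ T ∧ ∀ x ≥ T, x ^ A * Real.exp (-κ * R x) ≤ 1 := by
  obtain ⟨g, hg, T, hT1, hT⟩ := h.lowpow
  have h1 := tendsto_rpow_mul_exp_neg_mul_atTop_nhds_zero (A / g) κ hκ
  have h2 := h1.comp (tendsto_rpow_atTop hg)
  obtain ⟨T2, hT2⟩ := eventually_atTop.1 (h2.eventually (gt_mem_nhds one_pos))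
  refine ⟨max T T2, hT1.trans (le_max_left _ _), fun x hx => ?_⟩
  have hxT := (le_max_left _ _).trans hx
  have hx0 : 0 < x := by linarith
  have h3 := hT2 x ((le_max_right _ _).trans hx)
  have h4 := hT x hxT
  simp only [Function.comp] at h3
  rw [← Real.rpow_mul hx0.le, mul_div_cancel₀ _ hg.ne', Real.rpow_natCast] at h3
  refine le_trans ?_ h3.le
  gcongr x ^ A * Real.exp ?_
  nlinarith

theorem summ (h : RH R β c1) {b θ C : ℝ} (hθ : 0 ≤ θ) (hb : θ < b) (hC : 0 ≤ C) :
    Summable (fun j : ℕ => C * Real.exp (-b * R j) * (((j : ℝ) + 1) ^ 2 * Real.exp (θ * R (j + 1)))) := by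
  obtain ⟨D, hD, hs⟩ := h.step_bdd
  obtain ⟨T, hT1, hT⟩ := h.expdec (κ := b - θ) (by linarith) 4
  have hsum : Summable (fun j : ℕ => (4 * C * Real.exp (θ * D)) * (1 / (j : ℝ) ^ 2)) :=
    (Real.summable_one_div_nat_pow.2 (by norm_num)).mul_left _
  refine Summable.of_norm_bounded_eventually_nat hsum ?_
  filter_upwards [eventually_ge_atTop ⌈T⌉₊] with j hj
  have hjT : T ≤ j := Nat.ceil_le.1 hj
  have hj1 : (1 : ℝ) ≤ j := by linarith
  rw [Real.norm_of_nonneg (by positivity)]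
  have h1 := hT j hjT
  have h2 := hs j (by positivity)
  have h3 : Real.exp (θ * R (j + 1)) ≤ Real.exp (θ * D) * Real.exp (θ * R j) := by
    rw [← Real.exp_add]; gcongr; nlinarith
  have h4 : Real.exp (-b * R j) * Real.exp (θ * R j) = Real.exp (-(b - θ) * R j) := by
    rw [← Real.exp_add]; ring_nf
  calc C * Real.exp (-b * R j) * (((j : ℝ) + 1) ^ 2 * Real.exp (θ * R (j + 1)))
      ≤ C * Real.exp (-b * R j) * (((j : ℝ) + j) ^ 2 * (Real.exp (θ * D) * Real.exp (θ * R j))) := by gcongr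
    _ = 4 * C * Real.exp (θ * D) * ((j : ℝ) ^ 4 * (Real.exp (-b * R j) * Real.exp (θ * R j))) * (1 / (j : ℝ) ^ 2) := by
      field_simp; ring
    _ ≤ 4 * C * Real.exp (θ * D) * 1 * (1 / (j : ℝ) ^ 2) := by rw [h4]; gcongr
    _ = _ := by ring

theorem moment (h : RH R β c1) {b θ C : ℝ} (hθ : 0 ≤ θ) (hb : θ < b) (hC : 0 ≤ C) :
    ∃ K : ℝ, 0 ≤ K ∧ ∀ (q : PMF ℕ) (c : ℝ), 0 < c →
      (∀ t, 0 ≤ t → gwT q (c * t) ≤ ENNReal.ofReal (C * Real.exp (-b * R t))) →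
      gwE q (fun y => ENNReal.ofReal ((y / c) ^ 2 * Real.exp (θ * R (y / c)))) ≤ ENNReal.ofReal K := by
  have hsum := h.summ hθ hb hC
  refine ⟨∑' j : ℕ, C * Real.exp (-b * R j) * (((j : ℝ) + 1) ^ 2 * Real.exp (θ * R (j + 1))),
    tsum_nonneg (fun j => by positivity), fun q c hc hq => ?_⟩
  rw [ENNReal.ofReal_tsum_of_nonneg (fun j => by positivity) hsum]
  have key : ∀ y : ℕ, ENNReal.ofReal (((y : ℝ) / c) ^ 2 * Real.exp (θ * R (y / c))) ≤
      ∑' j : ℕ, (if c * j < (y : ℝ) then 1 else 0) * ENNReal.ofReal (((j : ℝ) + 1) ^ 2 * Real.exp (θ * R (j + 1))) := by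
    intro y
    rcases Nat.eq_zero_or_pos y with hy | hy
    · subst hy; simp
    have hY : 0 < (y : ℝ) / c := by positivity
    set Y := (y : ℝ) / c with hYd
    obtain ⟨j, hj⟩ : ∃ j, ⌈Y⌉₊ = j + 1 := Nat.exists_eq_succ_of_ne_zero (Nat.ceil_pos.2 hY).ne'
    have h1 : Y ≤ j + 1 := by
      have := Nat.le_ceil Y; rw [hj] at this; push_cast at this; exact this
    have h2 : (j : ℝ) < Y := by
      have := Nat.ceil_lt_add_one hY.le; rw [hj] at this; push_cast at this; linarith
    refine le_trans ?_ (ENNReal.le_tsum j)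
    rw [if_pos, one_mul]
    · apply ENNReal.ofReal_le_ofReal
      have := h.mono h1
      gcongr
    · rw [hYd, lt_div_iff₀ hc] at h2; linarith
  refine (gwE_mono q key).trans ?_
  rw [gwE_tsum]
  refine ENNReal.tsum_le_tsum fun j => ?_
  rw [gwE_mul_right, ENNReal.ofReal_mul (p := C * Real.exp (-b * R j)) (by positivity)]
  exact mul_le_mul' (hq j (by positivity)) le_rfl

theorem mgf (h : RH R β c1) {b θ C : ℝ} (c0 : ℝ) (hθ : 0 ≤ θ) (hb : θ < b) (hC : 0 ≤ C) :
    ∃ K : ℝ, 0 ≤ K ∧ ∀ (q : PMF ℕ) (c ν s u : ℝ), 0 < c → 0 ≤ ν → 0 ≤ s →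
      (∀ t, 0 ≤ t → gwT q (c * t) ≤ ENNReal.ofReal (C * Real.exp (-b * R t))) →
      gwE q (fun a => (a : ℝ≥0∞)) = ENNReal.ofReal (c * ν) →
      (∀ t, 0 ≤ t → t ≤ u → s * t ≤ θ * R t + c0) →
      gwE q (fun y => if (y : ℝ) ≤ c * u then ENNReal.ofReal (Real.exp (s / c * y)) else 0) ≤
        ENNReal.ofReal (Real.exp (s * ν + K * s ^ 2)) := by
  obtain ⟨K, hK, hm⟩ := h.moment hθ hb hC
  refine ⟨Real.exp c0 * K, by positivity, fun q c ν s u hc hν hs hq hmean hst => ?_⟩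
  have key : ∀ y : ℕ, (if (y : ℝ) ≤ c * u then ENNReal.ofReal (Real.exp (s / c * y)) else 0) ≤
      1 + (ENNReal.ofReal (s / c) * (y : ℝ≥0∞) + ENNReal.ofReal (s ^ 2 * Real.exp c0) *
        ENNReal.ofReal (((y : ℝ) / c) ^ 2 * Real.exp (θ * R (y / c)))) := by
    intro y
    split_ifs with hy
    · have hz : 0 ≤ s / c * y := by positivity
      have h1 := gw_exp_up hz
      have h2 := hst (y / c) (by positivity) (by rw [div_le_iff₀ hc]; linarith)
      have h3 : s / c * y = s * (y / c) := by ring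
      rw [← ENNReal.ofReal_natCast, ← ENNReal.ofReal_mul (by positivity), ← ENNReal.ofReal_mul (by positivity),
        ← ENNReal.ofReal_add (by positivity) (by positivity), ← ENNReal.ofReal_one,
        ← ENNReal.ofReal_add (by positivity) (by positivity)]
      apply ENNReal.ofReal_le_ofReal
      have h4 : Real.exp (s / c * y) ≤ Real.exp c0 * Real.exp (θ * R (y / c)) := by
        rw [← Real.exp_add]; gcongr; rw [h3]; linarith
      calc Real.exp (s / c * y) ≤ 1 + s / c * y + (s / c * y) ^ 2 * Real.exp (s / c * y) := h1
        _ ≤ 1 + s / c * y + (s / c * y) ^ 2 * (Real.exp c0 * Real.exp (θ * R (y / c))) := by gcongr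
        _ = _ := by rw [h3]; ring
    · exact bot_le
  refine (gwE_mono q key).trans ?_
  rw [gwE_add, gwE_add, gwE_const, gwE_mul_left, gwE_mul_left, hmean]
  calc _ ≤ 1 + (ENNReal.ofReal (s / c) * ENNReal.ofReal (c * ν) + ENNReal.ofReal (s ^ 2 * Real.exp c0) * ENNReal.ofReal K) := by
        gcongr; exact hm q c hc hq
    _ = ENNReal.ofReal (1 + (s / c * (c * ν) + s ^ 2 * Real.exp c0 * K)) := by
        rw [← ENNReal.ofReal_mul (by positivity), ← ENNReal.ofReal_mul (by positivity),
        ← ENNReal.ofReal_add (by positivity) (by positivity), ← ENNReal.ofReal_one,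
        ← ENNReal.ofReal_add (by positivity) (by positivity)]
    _ ≤ _ := by
        apply ENNReal.ofReal_le_ofReal
        have e1 : s / c * (c * ν) + s ^ 2 * Real.exp c0 * K = s * ν + Real.exp c0 * K * s ^ 2 := by
          field_simp
        rw [e1]
        have := Real.add_one_le_exp (s * ν + Real.exp c0 * K * s ^ 2)
        linarith

theorem mgf_neg (h : RH R β c1) {b C : ℝ} (hb : 0 < b) (hC : 0 ≤ C) :
    ∃ K : ℝ, 0 ≤ K ∧ ∀ (q : PMF ℕ) (c s : ℝ), 0 < c → 0 ≤ s →
      (∀ t, 0 ≤ t → gwT q (c * t) ≤ ENNReal.ofReal (C * Real.exp (-b * R t))) →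
      gwE q (fun a => (a : ℝ≥0∞)) = ENNReal.ofReal c →
      gwE q (fun y => ENNReal.ofReal (Real.exp (-(s / c) * y))) ≤
        ENNReal.ofReal (Real.exp (-s + K * s ^ 2)) := by
  obtain ⟨K, hK, hm⟩ := h.moment le_rfl hb hC
  refine ⟨K, hK, fun q c s hc hs hq hmean => ?_⟩
  have key : ∀ y : ℕ, ENNReal.ofReal (Real.exp (-(s / c) * y)) + ENNReal.ofReal (s / c) * (y : ℝ≥0∞) ≤
      1 + ENNReal.ofReal (s ^ 2) * ENNReal.ofReal (((y : ℝ) / c) ^ 2 * Real.exp (0 * R (y / c))) := by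
    intro y
    have hz : 0 ≤ s / c * y := by positivity
    have h1 := gw_exp_down hz
    rw [← ENNReal.ofReal_natCast, ← ENNReal.ofReal_mul (by positivity), ← ENNReal.ofReal_mul (by positivity),
      ← ENNReal.ofReal_add (by positivity) (by positivity), ← ENNReal.ofReal_one,
      ← ENNReal.ofReal_add (by positivity) (by positivity)]
    apply ENNReal.ofReal_le_ofReal
    rw [neg_mul, zero_mul, Real.exp_zero]
    refine h1.trans (le_of_eq ?_)
    ring
  have h2 := gwE_mono q key
  rw [gwE_add, gwE_add, gwE_const, gwE_mul_left, gwE_mul_left, hmean, ← ENNReal.ofReal_mul (by positivity),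
    div_mul_cancel₀ _ hc.ne'] at h2
  have h3 : gwE q (fun y => ENNReal.ofReal (Real.exp (-(s / c) * y))) + ENNReal.ofReal s ≤
      ENNReal.ofReal (Real.exp (-s + K * s ^ 2)) + ENNReal.ofReal s := by
    refine h2.trans ?_
    calc _ ≤ 1 + ENNReal.ofReal (s ^ 2) * ENNReal.ofReal K := by gcongr; exact hm q c hc hq
      _ = ENNReal.ofReal (1 + s ^ 2 * K) := by
        rw [← ENNReal.ofReal_mul (by positivity), ← ENNReal.ofReal_one, ← ENNReal.ofReal_add (by positivity) (by positivity)]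
      _ ≤ ENNReal.ofReal (Real.exp (-s + K * s ^ 2) + s) := by
        apply ENNReal.ofReal_le_ofReal
        have := Real.add_one_le_exp (-s + K * s ^ 2)
        linarith
      _ = _ := ENNReal.ofReal_add (by positivity) hs
  exact (ENNReal.add_le_add_iff_right ENNReal.ofReal_ne_top).1 h3

/-- large deviation bound -/
theorem ldev (h : RH R β c1) {b θ C ν : ℝ} (hθ : 0 < θ) (hb : θ < b) (hC : 0 ≤ C) (hν : 0 ≤ ν) :
    ∃ K : ℝ, 0 ≤ K ∧ ∀ (q : PMF ℕ) (c : ℝ), 0 < c →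
      (∀ t, 0 ≤ t → gwT q (c * t) ≤ ENNReal.ofReal (C * Real.exp (-b * R t))) →
      gwE q (fun a => (a : ℝ≥0∞)) = ENNReal.ofReal (c * ν) →
      ∀ (N : ℝ) (k : ℕ) (u a : ℝ), 1 ≤ N → (k : ℝ) ≤ N → 1 ≤ u → ν * k + u ≤ a →
      gwT (gwPw q k) (c * a) ≤ ENNReal.ofReal (N * C * Real.exp (-b * R u) +
        K * (Real.exp (-(u / Real.sqrt N)) + Real.exp (-(θ * R u)))) := by
  set η := (b / θ - 1) / 2 with hη
  have hη0 : 0 < η := by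
    have : 1 < b / θ := by rw [lt_div_iff₀ hθ]; linarith
    rw [hη]; linarith
  have hηb : (1 + η) * θ < b := by
    have h1 : b / θ * θ = b := by field_simp
    rw [hη]; nlinarith
  obtain ⟨T, hT1, hT⟩ := h.qd hη0
  obtain ⟨K, hK, hmgf⟩ := h.mgf T (θ := (1 + η) * θ) (by positivity) hηb hC
  refine ⟨Real.exp K, by positivity, fun q c hc hq hmean N k u a hN hk hu ha => ?_⟩
  have hu0 : 0 < u := by linarith
  have hRu := h.nonneg u
  have hsN : 1 ≤ Real.sqrt N := Real.one_le_sqrt.2 hN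
  set s := min (1 / Real.sqrt N) (θ * R u / u) with hs
  have hs0 : 0 ≤ s := le_min (by positivity) (by positivity)
  have hs1 : s ≤ 1 := (min_le_left _ _).trans (by rw [div_le_one (by linarith)]; exact hsN)
  have hs2 : N * s ^ 2 ≤ 1 := by
    have h1 : s ≤ 1 / Real.sqrt N := min_le_left _ _
    calc N * s ^ 2 ≤ N * (1 / Real.sqrt N) ^ 2 := by gcongr
      _ = 1 := by rw [div_pow, Real.sq_sqrt (by linarith)]; field_simp
  have hst : ∀ t, 0 ≤ t → t ≤ u → s * t ≤ (1 + η) * θ * R t + T := by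
    intro t ht0 htu
    have hRt := h.nonneg t
    by_cases htT : T ≤ t
    · have h1 := hT t htT u htu
      have h2 : s ≤ θ * R u / u := min_le_right _ _
      have : s * t ≤ (1 + η) * θ * R t := by
        calc s * t ≤ θ * R u / u * t := by gcongr
          _ = θ / u * (R u * t) := by field_simp
          _ ≤ θ / u * ((1 + η) * R t * u) := by gcongr
          _ = _ := by field_simp
      linarith
    · push Not at htT
      have : 0 ≤ (1 + η) * θ * R t := by positivity
      nlinarith
  have h1 := hmgf q c ν s u hc hν hs0 hq hmean hst
  have h2 := gw_nagaev q (s / c) (c * u) (by positivity) k (c * a)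
  refine h2.trans ?_
  have hE : Real.exp (-(s / c) * (c * a)) * Real.exp (s * ν + K * s ^ 2) ^ k ≤
      Real.exp K * (Real.exp (-(u / Real.sqrt N)) + Real.exp (-(θ * R u))) := by
    rw [← Real.exp_nat_mul, ← Real.exp_add]
    have e1 : -(s / c) * (c * a) + k * (s * ν + K * s ^ 2) ≤ K + -(s * u) := by
      have e2 : -(s / c) * (c * a) = - (s * a) := by field_simp
      have e3 : k * (K * s ^ 2) ≤ K := by
        calc k * (K * s ^ 2) ≤ N * (K * s ^ 2) := by gcongr
          _ = K * (N * s ^ 2) := by ring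
          _ ≤ K * 1 := by gcongr
          _ = K := mul_one _
      rw [e2]
      nlinarith
    calc _ ≤ Real.exp (K + -(s * u)) := by gcongr
      _ = Real.exp K * Real.exp (-(s * u)) := Real.exp_add _ _
      _ ≤ _ := by
        gcongr
        rcases min_choice (1 / Real.sqrt N) (θ * R u / u) with h3 | h3
        · rw [← hs] at h3
          rw [h3, one_div_mul_eq_div]
          have := Real.exp_pos (-(θ * R u)); linarith
        · rw [← hs] at h3
          rw [h3, div_mul_cancel₀ _ hu0.ne']
          have := Real.exp_pos (-(u / Real.sqrt N)); linarith
  calc _ ≤ ENNReal.ofReal N * ENNReal.ofReal (C * Real.exp (-b * R u)) +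
        ENNReal.ofReal (Real.exp (-(s / c) * (c * a))) * (ENNReal.ofReal (Real.exp (s * ν + K * s ^ 2))) ^ k := by
        gcongr
        · rw [← ENNReal.ofReal_natCast]; exact ENNReal.ofReal_le_ofReal hk
        · exact hq u hu0.le
    _ = ENNReal.ofReal (N * (C * Real.exp (-b * R u)) + Real.exp (-(s / c) * (c * a)) * Real.exp (s * ν + K * s ^ 2) ^ k) := by
        rw [← ENNReal.ofReal_mul (by positivity), ← ENNReal.ofReal_pow (by positivity), ← ENNReal.ofReal_mul (by positivity),
          ← ENNReal.ofReal_add (by positivity) (by positivity)]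
    _ ≤ _ := by
        apply ENNReal.ofReal_le_ofReal
        rw [mul_assoc]
        gcongr

end RH

open MeasureTheory Filter ProbabilityTheory

open scoped ENNReal

namespace RH
variable {R : ℝ → ℝ} {β c1 : ℝ}

theorem D_le (h : RH R β c1) {e T : ℝ} (he : 0 < e) (hT1 : 1 ≤ T)
    (hT : ∀ x ≥ T, R x ≤ x ^ (1 / 2 - 2 * e)) :
    ∃ X0 : ℝ, 1 ≤ X0 ∧ ∀ X ≥ X0, ∀ u, 1 ≤ u → u ≤ X → R X - R (X - u) ≤ u / (2 * Real.sqrt X) * X ^ (-(3 / 2 * e)) := by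
  obtain ⟨C, hC, hi⟩ := h.incr_real
  obtain ⟨T2, hT2⟩ := eventually_atTop.1 ((tendsto_rpow_atTop (y := e / 2) (by linarith)).eventually_ge_atTop (4 * C))
  refine ⟨max T T2, hT1.trans (le_max_left _ _), fun X hX u hu huX => ?_⟩
  have hXT := (le_max_left _ _).trans hX
  have hX0 : 0 < X := by linarith
  have h1 := hi X hX0 u (by linarith) huX
  have h2 := hT X hXT
  have h3 := hT2 X ((le_max_right _ _).trans hX)
  have e1 : X ^ (1 / 2 - 2 * e) = X / Real.sqrt X * X ^ (-(3 / 2 * e)) * X ^ (-(e / 2)) := by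
    rw [Real.div_sqrt, Real.sqrt_eq_rpow, ← Real.rpow_add hX0, ← Real.rpow_add hX0]; ring_nf
  have e2 : X ^ (-(e / 2)) * X ^ (e / 2) = 1 := by
    rw [← Real.rpow_add hX0]; simp
  have hsq : 0 < Real.sqrt X := Real.sqrt_pos.2 hX0
  have hp : 0 < X ^ (-(3 / 2 * e)) := by positivity
  have hp2 : 0 < X ^ (-(e / 2)) := by positivity
  have hRX := h.nonneg X
  calc R X - R (X - u) ≤ C * ((u + 1) * R X / X) := h1
    _ ≤ C * ((u + u) * (X / Real.sqrt X * X ^ (-(3 / 2 * e)) * X ^ (-(e / 2))) / X) := by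
      rw [← e1]; gcongr
    _ = u / (2 * Real.sqrt X) * X ^ (-(3 / 2 * e)) * ((4 * C) * X ^ (-(e / 2))) := by field_simp; ring
    _ ≤ u / (2 * Real.sqrt X) * X ^ (-(3 / 2 * e)) * (X ^ (e / 2) * X ^ (-(e / 2))) := by gcongr
    _ = _ := by rw [mul_comm (X ^ (e / 2)), e2, mul_one]

theorem hle {e X : ℝ} (he8 : e < 1 / 8) (hX : 1 ≤ X) : X ^ (1 / 2 + e) ≤ X := by
  have : X ^ (1 / 2 + e) ≤ X ^ (1 : ℝ) := Real.rpow_le_rpow_of_exponent_le hX (by linarith)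
  rwa [Real.rpow_one] at this

theorem hsplit {e X : ℝ} (hX : 0 < X) : X ^ (1 / 2 + e) = Real.sqrt X * X ^ e := by
  rw [Real.sqrt_eq_rpow, ← Real.rpow_add hX]

theorem insens (h : RH R β c1) {e T : ℝ} (he : 0 < e) (he8 : e < 1 / 8) (hT1 : 1 ≤ T)
    (hT : ∀ x ≥ T, R x ≤ x ^ (1 / 2 - 2 * e)) {ε : ℝ} (hε : 0 < ε) :
    ∃ X0 : ℝ, 1 ≤ X0 ∧ ∀ X ≥ X0, R X - R (X - X ^ (1 / 2 + e)) ≤ ε := by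
  obtain ⟨T1, hT11, hD⟩ := h.D_le he hT1 hT
  obtain ⟨T2, hT2⟩ := eventually_atTop.1 ((tendsto_rpow_neg_atTop (y := e / 2) (by linarith)).eventually (gt_mem_nhds hε))
  refine ⟨max T1 T2, hT11.trans (le_max_left _ _), fun X hX => ?_⟩
  have hXT := (le_max_left _ _).trans hX
  have hX1 : 1 ≤ X := by linarith
  have hX0 : 0 < X := by linarith
  have h1 := hD X hXT (X ^ (1 / 2 + e)) (Real.one_le_rpow hX1 (by linarith)) (hle he8 hX1)
  have h2 := hT2 X ((le_max_right _ _).trans hX)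
  refine h1.trans (le_trans ?_ h2.le)
  rw [hsplit hX0]
  have hsq : 0 < Real.sqrt X := Real.sqrt_pos.2 hX0
  have e1 : X ^ e * X ^ (-(3 / 2 * e)) = X ^ (-(e / 2)) := by rw [← Real.rpow_add hX0]; ring_nf
  have : 0 < X ^ (-(e / 2)) := by positivity
  calc Real.sqrt X * X ^ e / (2 * Real.sqrt X) * X ^ (-(3 / 2 * e)) = (X ^ e * X ^ (-(3 / 2 * e))) / 2 := by field_simp
    _ ≤ _ := by rw [e1]; linarith

theorem anal (h : RH R β c1) {e T : ℝ} (he : 0 < e) (hT1 : 1 ≤ T)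
    (hT : ∀ x ≥ T, R x ≤ x ^ (1 / 2 - 2 * e)) {b C K κ : ℝ} (hκ : 0 < κ) (hb : b = 1 + 3 * κ) (hC : 0 ≤ C) (hK : 0 ≤ K) :
    ∃ X0 : ℝ, 1 ≤ X0 ∧ ∀ X ≥ X0, ∀ u, X ^ (1 / 2 + e) ≤ u → u ≤ X →
      Real.exp (-R (X - u)) * (X * C * Real.exp (-b * R u) + K * (Real.exp (-(u / Real.sqrt X)) + Real.exp (-((1 + 2 * κ) * R u))))
        ≤ (C + 2 * K) / X ^ 2 * Real.exp (-R X) := by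
  obtain ⟨T1, hT11, hD⟩ := h.D_le he hT1 hT
  obtain ⟨T2, hT21, hS⟩ := h.sub_add (b := 1 + κ) (by linarith)
  obtain ⟨T3, hT31, hE⟩ := h.expdec hκ 6
  have hlim : Tendsto (fun X : ℝ => (X ^ e) ^ (2 / e) * Real.exp (-(1 / 2) * X ^ e)) atTop (nhds 0) :=
    (tendsto_rpow_mul_exp_neg_mul_atTop_nhds_zero (2 / e) (1 / 2) (by norm_num)).comp (tendsto_rpow_atTop he)
  obtain ⟨T4, hT4⟩ := eventually_atTop.1 (hlim.eventually (gt_mem_nhds one_pos))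
  refine ⟨max (max T1 T4) (max (T2 ^ 2) (T3 ^ 2)), hT11.trans ((le_max_left _ _).trans (le_max_left _ _)), fun X hX u hu huX => ?_⟩
  have hX1 : T1 ≤ X := ((le_max_left _ _).trans (le_max_left _ _)).trans hX
  have hX4 : T4 ≤ X := ((le_max_right _ _).trans (le_max_left _ _)).trans hX
  have hX2 : T2 ^ 2 ≤ X := ((le_max_left _ _).trans (le_max_right _ _)).trans hX
  have hX3 : T3 ^ 2 ≤ X := ((le_max_right _ _).trans (le_max_right _ _)).trans hX
  have hXone : 1 ≤ X := by linarith
  have hX0 : 0 < X := by linarith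
  have hsq : 0 < Real.sqrt X := Real.sqrt_pos.2 hX0
  have hXe : 1 ≤ X ^ e := Real.one_le_rpow hXone he.le
  rw [hsplit hX0] at hu
  have hus : Real.sqrt X ≤ u := by nlinarith
  have hsq1 : 1 ≤ Real.sqrt X := Real.one_le_sqrt.2 hXone
  have hu2 : T2 ≤ u := (Real.le_sqrt_of_sq_le hX2).trans hus
  have hu3 : T3 ≤ u := (Real.le_sqrt_of_sq_le hX3).trans hus
  have hu0 : 0 < u := by linarith
  have d1 : R X - R (X - u) ≤ u / (2 * Real.sqrt X) := by
    refine (hD X hX1 u (by linarith) huX).trans ?_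
    have : X ^ (-(3 / 2 * e)) ≤ 1 := Real.rpow_le_one_of_one_le_of_nonpos hXone (by linarith)
    exact mul_le_of_le_one_right (by positivity) this
  have d2 := hS u hu2 X huX
  have hRu := h.nonneg u
  have hEu := hE u hu3
  -- e^{-κ R u} ≤ X^{-3}
  have k1 : Real.exp (-κ * R u) ≤ 1 / X ^ 3 := by
    have : X ^ 3 ≤ u ^ 6 := by
      calc X ^ 3 = (Real.sqrt X) ^ 6 := by
            rw [show (6 : ℕ) = 2 * 3 by norm_num, pow_mul, Real.sq_sqrt hX0.le]
        _ ≤ u ^ 6 := by gcongr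
    rw [le_div_iff₀ (by positivity)]
    calc Real.exp (-κ * R u) * X ^ 3 ≤ Real.exp (-κ * R u) * u ^ 6 := by gcongr
      _ ≤ 1 := by linarith
  have k2 : Real.exp (-(u / (2 * Real.sqrt X))) ≤ 1 / X ^ 2 := by
    have h5 := hT4 X hX4
    rw [← Real.rpow_mul hX0.le, mul_div_cancel₀ _ he.ne', Real.rpow_ofNat] at h5
    rw [le_div_iff₀ (by positivity)]
    refine le_trans ?_ h5.le
    rw [mul_comm]
    gcongr X ^ 2 * Real.exp ?_
    have : X ^ e ≤ u / Real.sqrt X := by rw [le_div_iff₀ hsq]; linarith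
    have e3 : u / (2 * Real.sqrt X) = (u / Real.sqrt X) / 2 := by field_simp
    rw [e3]; linarith
  have a1 : Real.exp (-R (X - u)) * Real.exp (-b * R u) ≤ 1 / X ^ 3 * Real.exp (-R X) := by
    refine le_trans ?_ (mul_le_mul_of_nonneg_right k1 (Real.exp_pos _).le)
    rw [← Real.exp_add, ← Real.exp_add]
    apply Real.exp_le_exp.2
    rw [hb]; nlinarith
  have a2 : Real.exp (-R (X - u)) * Real.exp (-((1 + 2 * κ) * R u)) ≤ 1 / X ^ 3 * Real.exp (-R X) := by
    refine le_trans ?_ (mul_le_mul_of_nonneg_right k1 (Real.exp_pos _).le)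
    rw [← Real.exp_add, ← Real.exp_add]
    apply Real.exp_le_exp.2
    nlinarith
  have a3 : Real.exp (-R (X - u)) * Real.exp (-(u / Real.sqrt X)) ≤ 1 / X ^ 2 * Real.exp (-R X) := by
    refine le_trans ?_ (mul_le_mul_of_nonneg_right k2 (Real.exp_pos _).le)
    rw [← Real.exp_add, ← Real.exp_add]
    apply Real.exp_le_exp.2
    have e3 : u / (2 * Real.sqrt X) = (u / Real.sqrt X) / 2 := by field_simp
    rw [e3] at d1 ⊢; linarith
  have a4 : 1 / X ^ 3 * Real.exp (-R X) ≤ 1 / X ^ 2 * Real.exp (-R X) := by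
    exact mul_le_mul_of_nonneg_right (one_div_le_one_div_of_le (by positivity) (pow_le_pow_right₀ hXone (by norm_num))) (Real.exp_pos _).le
  calc _ = X * C * (Real.exp (-R (X - u)) * Real.exp (-b * R u)) + K * (Real.exp (-R (X - u)) * Real.exp (-(u / Real.sqrt X))
        + Real.exp (-R (X - u)) * Real.exp (-((1 + 2 * κ) * R u))) := by ring
    _ ≤ X * C * (1 / X ^ 3 * Real.exp (-R X)) + K * (1 / X ^ 2 * Real.exp (-R X) + 1 / X ^ 2 * Real.exp (-R X)) := by
      exact add_le_add (mul_le_mul_of_nonneg_left a1 (by positivity)) (mul_le_mul_of_nonneg_left (add_le_add a3 (a2.trans a4)) hK)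
    _ = _ := by field_simp; ring

theorem upper (h : RH R β c1) (p : PMF ℕ) (hp : ∀ t, gwT p t = ENNReal.ofReal (Real.exp (-R t)))
    {b C ε : ℝ} (hb : 1 < b) (hC : 0 ≤ C) (hε : 0 < ε) :
    ∃ X0 : ℝ, 1 ≤ X0 ∧ ∀ (q : PMF ℕ) (c : ℝ), 0 < c →
      (∀ t, 0 ≤ t → gwT q (c * t) ≤ ENNReal.ofReal (C * Real.exp (-b * R t))) →
      gwE q (fun a => (a : ℝ≥0∞)) = ENNReal.ofReal c →
      ∀ X ≥ X0, gwE p (fun k => gwT (gwPw q k) (c * X)) ≤ ENNReal.ofReal ((1 + ε) * Real.exp (-R X)) := by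
  obtain ⟨e, he, he8, T, hT1, hT⟩ := h.half
  set κ := (b - 1) / 3 with hκ
  have hκ0 : 0 < κ := by rw [hκ]; linarith
  have hbκ : b = 1 + 3 * κ := by rw [hκ]; ring
  obtain ⟨K, hK, hld⟩ := h.ldev (b := b) (θ := 1 + 2 * κ) (C := C) (ν := 1) (by linarith) (by linarith) hC zero_le_one
  obtain ⟨X1, hX11, hA⟩ := h.anal he hT1 hT hκ0 hbκ hC hK
  obtain ⟨D, hD, hstep⟩ := h.step_bdd
  set D1 := D + R 0 with hD1
  have hR0 := h.nonneg 0
  -- insensitivity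
  have hl : 0 < Real.log (1 + ε / 2) := Real.log_pos (by linarith)
  obtain ⟨X2, hX21, hI⟩ := h.insens he he8 hT1 hT hl
  set V := 2 * (Real.exp D1 * (C + 2 * K)) with hV
  refine ⟨max (max X1 X2) (2 * V / ε), hX11.trans ((le_max_left _ _).trans (le_max_left _ _)),
    fun q c hc hq hmean X hX => ?_⟩
  have hXX1 : X1 ≤ X := ((le_max_left _ _).trans (le_max_left _ _)).trans hX
  have hXX2 : X2 ≤ X := ((le_max_right _ _).trans (le_max_left _ _)).trans hX
  have hXX3 : 2 * V / ε ≤ X := (le_max_right _ _).trans hX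
  have hX1 : 1 ≤ X := by linarith
  have hX0 : 0 < X := by linarith
  set H := X ^ (1 / 2 + e) with hH
  have hH1 : 1 ≤ H := Real.one_le_rpow hX1 (by linarith)
  set v := Real.exp D1 * ((C + 2 * K) / X ^ 2 * Real.exp (-R X)) with hv
  have hv0 : 0 ≤ v := by rw [hv]; positivity
  have key : ∀ k : ℕ, p k * gwT (gwPw q k) (c * X) ≤
      p k * (if X - H < (k : ℝ) then 1 else 0) + (if k ∈ Finset.range (⌊X⌋₊ + 1) then ENNReal.ofReal v else 0) := by
    intro k
    by_cases hk : X - H < (k : ℝ)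
    · rw [if_pos hk]
      refine le_trans ?_ le_self_add
      gcongr
      exact gwT_le_one _ _
    · rw [if_neg hk, mul_zero, zero_add]
      push Not at hk
      have hkX : (k : ℝ) ≤ X := by linarith
      rw [if_pos (by rw [Finset.mem_range, Nat.lt_succ_iff]; exact Nat.le_floor hkX)]
      have h1 := hld q c hc hq (by rw [mul_one]; exact hmean) X k (X - k) X hX1 hkX (by linarith) (by linarith)
      have h2 := hA X hXX1 (X - k) (by linarith) (by have : (0 : ℝ) ≤ k := by positivity
                                                     linarith)
      rw [sub_sub_cancel] at h2
      have h3 : p k ≤ ENNReal.ofReal (Real.exp D1 * Real.exp (-R k)) := by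
        have h4 : p k ≤ gwT p ((k : ℝ) - 1) := by
          unfold gwT gwE
          refine le_trans ?_ (ENNReal.le_tsum k)
          show p k ≤ p k * (if (k:ℝ) - 1 < (k:ℝ) then 1 else 0)
          rw [if_pos (by linarith), mul_one]
        refine h4.trans ?_
        rw [hp, ← Real.exp_add]
        apply ENNReal.ofReal_le_ofReal
        gcongr
        rcases Nat.eq_zero_or_pos k with h0 | h0
        · subst h0
          have := h.nonneg (((0 : ℕ) : ℝ) - 1)
          push_cast at *
          linarith
        · have hk1 : (1 : ℝ) ≤ k := by exact_mod_cast h0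
          have := hstep ((k : ℝ) - 1) (by linarith)
          rw [sub_add_cancel] at this
          linarith
      refine (mul_le_mul' h3 h1).trans ?_
      rw [← ENNReal.ofReal_mul (by positivity)]
      apply ENNReal.ofReal_le_ofReal
      rw [hv, mul_assoc]
      gcongr
  calc gwE p (fun k => gwT (gwPw q k) (c * X)) ≤ ∑' k, (p k * (if X - H < (k : ℝ) then 1 else 0) + (if k ∈ Finset.range (⌊X⌋₊ + 1) then ENNReal.ofReal v else 0)) :=
        ENNReal.tsum_le_tsum key
    _ = gwT p (X - H) + ((⌊X⌋₊ + 1 : ℕ) : ℝ≥0∞) * ENNReal.ofReal v := by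
        rw [ENNReal.tsum_add]
        congr 1
        rw [tsum_eq_sum (s := Finset.range (⌊X⌋₊ + 1)) (fun k hk => if_neg hk), Finset.sum_congr rfl (fun k hk => if_pos hk)]
        simp
    _ = ENNReal.ofReal (Real.exp (-R (X - H)) + ((⌊X⌋₊ : ℝ) + 1) * v) := by
        rw [hp, ← ENNReal.ofReal_natCast, ← ENNReal.ofReal_mul (by positivity), ← ENNReal.ofReal_add (by positivity) (by positivity)]
        push_cast; rfl
    _ ≤ _ := by
        apply ENNReal.ofReal_le_ofReal
        have f1 : Real.exp (-R (X - H)) ≤ (1 + ε / 2) * Real.exp (-R X) := by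
          have := hI X hXX2
          rw [← Real.exp_log (show 0 < 1 + ε / 2 by linarith), ← Real.exp_add]
          gcongr
          linarith
        have f2 : ((⌊X⌋₊ : ℝ) + 1) * v ≤ ε / 2 * Real.exp (-R X) := by
          have : ((⌊X⌋₊ : ℝ) + 1) ≤ 2 * X := by have := Nat.floor_le hX0.le; linarith
          calc ((⌊X⌋₊ : ℝ) + 1) * v ≤ 2 * X * v := by gcongr
            _ = V / X * Real.exp (-R X) := by rw [hv, hV]; field_simp
            _ ≤ _ := by
              refine mul_le_mul_of_nonneg_right ?_ (Real.exp_pos _).le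
              rw [div_le_iff₀ hε] at hXX3
              rw [div_le_iff₀ hX0]; linarith
        linarith

theorem lower (h : RH R β c1) (p : PMF ℕ) (hp : ∀ t, gwT p t = ENNReal.ofReal (Real.exp (-R t)))
    {b C ε : ℝ} (hb : 1 < b) (hC : 0 ≤ C) (hε : 0 < ε) (hε1 : ε < 1) :
    ∃ X0 : ℝ, 1 ≤ X0 ∧ ∀ (q : PMF ℕ) (c : ℝ), 0 < c →
      (∀ t, 0 ≤ t → gwT q (c * t) ≤ ENNReal.ofReal (C * Real.exp (-b * R t))) →
      gwE q (fun a => (a : ℝ≥0∞)) = ENNReal.ofReal c →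
      ∀ X ≥ X0, ENNReal.ofReal ((1 - ε) * Real.exp (-R X)) ≤ gwE p (fun k => gwT (gwPw q k) (c * X)) := by
  obtain ⟨e, he, he8, T, hT1, hT⟩ := h.half
  obtain ⟨K, hK, hmg⟩ := h.mgf_neg (b := b) (C := C) (by linarith) hC
  have hl : 0 < -Real.log (1 - ε / 2) := by
    have := Real.log_neg (show 0 < 1 - ε / 2 by linarith) (by linarith); linarith
  obtain ⟨X2, hX21, hI⟩ := h.insens he he8 hT1 hT hl
  obtain ⟨X3, hX3⟩ := eventually_atTop.1 ((tendsto_rpow_atTop he).eventually_ge_atTop (2 * K - Real.log (ε / 2)))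
  refine ⟨max (max X2 X3) (K ^ 2), hX21.trans ((le_max_left _ _).trans (le_max_left _ _)),
    fun q c hc hq hmean X hX => ?_⟩
  have hXX1 : X2 ≤ X := ((le_max_left _ _).trans (le_max_left _ _)).trans hX
  have hXX2 : X3 ≤ X := ((le_max_right _ _).trans (le_max_left _ _)).trans hX
  have hXX3 : K ^ 2 ≤ X := (le_max_right _ _).trans hX
  have hX1 : 1 ≤ X := by linarith
  have hX0 : 0 < X := by linarith
  set H := X ^ (1 / 2 + e) with hH
  have hH1 : 1 ≤ H := Real.one_le_rpow hX1 (by linarith)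
  have hsq : 0 < Real.sqrt X := Real.sqrt_pos.2 hX0
  set s := 1 / Real.sqrt X with hs
  have hs0 : 0 < s := by positivity
  have hsX : s ^ 2 * X = 1 := by rw [hs, div_pow, Real.sq_sqrt hX0.le]; field_simp
  have hKs : K * s ≤ 1 := by
    have := Real.le_sqrt_of_sq_le hXX3
    rw [hs, mul_one_div, div_le_one hsq]; exact this
  have key : ∀ k : ℕ, ENNReal.ofReal (1 - ε / 2) * (if X + H < (k : ℝ) then 1 else 0) ≤ gwT (gwPw q k) (c * X) := by
    intro k
    split_ifs with hk
    · rw [mul_one]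
      have h1 := gw_lower q (s / c) (by positivity) k (c * X)
      have h2 := hmg q c s hc hs0.le hq hmean
      have h3 : gwE (gwPw q k) (fun b => if (b : ℝ) ≤ c * X then 1 else 0) ≤ ENNReal.ofReal (ε / 2) := by
        refine h1.trans ?_
        calc _ ≤ ENNReal.ofReal (Real.exp (s / c * (c * X))) * ENNReal.ofReal (Real.exp (-s + K * s ^ 2)) ^ k := by gcongr
          _ = ENNReal.ofReal (Real.exp (s * X + k * (-s + K * s ^ 2))) := by
            rw [← ENNReal.ofReal_pow (by positivity), ← ENNReal.ofReal_mul (by positivity), ← Real.exp_nat_mul, ← Real.exp_add]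
            congr 3; field_simp
          _ ≤ _ := by
            apply ENNReal.ofReal_le_ofReal
            rw [← Real.exp_log (show 0 < ε / 2 by linarith)]
            gcongr
            have g1 : (k : ℝ) * (-s + K * s ^ 2) ≤ (X + H) * (-s + K * s ^ 2) := by
              have : -s + K * s ^ 2 ≤ 0 := by nlinarith
              nlinarith
            have g2 : H * s = X ^ e := by rw [hH, hsplit hX0, hs]; field_simp
            have g3 : H ≤ X := hle he8 hX1
            have g4 := hX3 X hXX2
            have g5 : (X + H) * (K * s ^ 2) ≤ 2 * K := by
              calc (X + H) * (K * s ^ 2) ≤ (X + X) * (K * s ^ 2) := by gcongr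
                _ = 2 * K * (s ^ 2 * X) := by ring
                _ = 2 * K := by rw [hsX, mul_one]
            nlinarith
      have h4 : (1 : ℝ≥0∞) = gwT (gwPw q k) (c * X) + gwE (gwPw q k) (fun b => if (b : ℝ) ≤ c * X then 1 else 0) := by
        unfold gwT
        refine (gwE_const (gwPw q k) 1).symm.trans ?_
        rw [← gwE_add]
        congr 1; ext b
        by_cases hb2 : c * X < (b : ℝ)
        · rw [if_pos hb2, if_neg (not_le.2 hb2)]; simp
        · rw [if_neg hb2, if_pos (not_lt.1 hb2)]; simp
      have h5 : ENNReal.ofReal (1 - ε / 2) + ENNReal.ofReal (ε / 2) ≤ gwT (gwPw q k) (c * X) + ENNReal.ofReal (ε / 2) := by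
        rw [← ENNReal.ofReal_add (by linarith) (by linarith), sub_add_cancel, ENNReal.ofReal_one, h4]
        gcongr
      exact (ENNReal.add_le_add_iff_right ENNReal.ofReal_ne_top).1 h5
    · rw [mul_zero]; exact bot_le
  refine le_trans ?_ (gwE_mono p key)
  rw [gwE_mul_left]
  change _ ≤ _ * gwT p (X + H)
  rw [hp, ← ENNReal.ofReal_mul (by linarith)]
  apply ENNReal.ofReal_le_ofReal
  have f1 : (1 - ε / 2) * Real.exp (-R X) ≤ Real.exp (-R (X + H)) := by
    have h1 := hI (X + H) (by linarith)
    have h2 : X + H - (X + H) ^ (1 / 2 + e) ≤ X := by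
      have : H ≤ (X + H) ^ (1 / 2 + e) := Real.rpow_le_rpow hX0.le (by linarith) (by linarith)
      linarith
    have h3 := h.mono h2
    rw [← Real.exp_log (show 0 < 1 - ε / 2 by linarith), ← Real.exp_add]
    gcongr
    linarith
  calc (1 - ε) * Real.exp (-R X) ≤ ((1 - ε / 2) * (1 - ε / 2)) * Real.exp (-R X) := by
        gcongr; nlinarith
    _ = (1 - ε / 2) * ((1 - ε / 2) * Real.exp (-R X)) := by ring
    _ ≤ _ := by gcongr; linarith

end RH

open MeasureTheory Filter ProbabilityTheory

open scoped ENNReal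

theorem gw_expo {B c : ℝ} (hB : 1 < B) (hc : 0 < c) (M : ℝ) :
    ∃ n0 : ℕ, ∀ j : ℕ, n0 ≤ j → M * ((j : ℝ) + 1) ≤ c * B ^ j := by
  have h1 := tendsto_pow_const_div_const_pow_of_one_lt 1 hB
  have h2 := tendsto_pow_const_div_const_pow_of_one_lt 0 hB
  have h3 := (h1.add h2).const_mul M
  simp only [add_zero, mul_zero] at h3
  obtain ⟨n0, hn⟩ := eventually_atTop.1 (h3.eventually (gt_mem_nhds hc))
  refine ⟨n0, fun j hj => ?_⟩
  have h4 := hn j hj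
  have hBj : 0 < B ^ j := by positivity
  have h5 : M * ((j : ℝ) + 1) = M * ((j : ℝ) ^ 1 / B ^ j + (j : ℝ) ^ 0 / B ^ j) * B ^ j := by
    field_simp; try ring
  rw [h5]
  exact mul_le_mul_of_nonneg_right h4.le hBj.le

namespace RH
variable {R : ℝ → ℝ} {β c1 : ℝ}

theorem small (h : RH R β c1) {b κ C T : ℝ} (hb : 0 < b) (hκ : 0 < κ) (f : ℝ → ℝ≥0∞) (hf : ∀ t, f t ≤ 1)
    (hT : ∀ t ≥ T, f t ≤ ENNReal.ofReal (C * Real.exp (-b * R (κ * t)))) :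
    ∃ C' : ℝ, 0 ≤ C' ∧ ∀ t, f t ≤ ENNReal.ofReal (C' * Real.exp (-b * R (κ * t))) := by
  refine ⟨max C (Real.exp (b * R (κ * T))), (Real.exp_pos _).le.trans (le_max_right _ _), fun t => ?_⟩
  rcases le_total T t with h1 | h1
  · refine (hT t h1).trans (ENNReal.ofReal_le_ofReal ?_)
    exact mul_le_mul_of_nonneg_right (le_max_left _ _) (Real.exp_pos _).le
  · refine (hf t).trans ?_
    rw [← ENNReal.ofReal_one]
    apply ENNReal.ofReal_le_ofReal
    have h2 : R (κ * t) ≤ R (κ * T) := h.mono (by gcongr)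
    calc (1 : ℝ) ≤ Real.exp (b * R (κ * T)) * Real.exp (-b * R (κ * t)) := by
          rw [← Real.exp_add]
          apply Real.one_le_exp
          nlinarith
      _ ≤ _ := mul_le_mul_of_nonneg_right (le_max_right _ _) (Real.exp_pos _).le

theorem gwT_succ (p : PMF ℕ) (n : ℕ) (t : ℝ) :
    gwT (gwK p (n + 1) 1) t = gwE p (fun k => gwT (gwPw (gwK p n 1) k) t) := by
  rw [gwK_succ_branch]; unfold gwT; rw [gwE_bind]

theorem gwT_succ' (p : PMF ℕ) (n : ℕ) (t : ℝ) :
    gwT (gwK p (n + 1) 1) t = gwE (gwK p n 1) (fun k => gwT (gwPw p k) t) := by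
  show gwT ((gwK p n 1).bind (gwPw p)) t = _
  unfold gwT; rw [gwE_bind]

theorem mean_n (p : PMF ℕ) {m : ℝ} (hm : 1 < m) (hmean : gwE p (fun a => (a : ℝ≥0∞)) = ENNReal.ofReal m) (n : ℕ) :
    gwE (gwK p n 1) (fun a => (a : ℝ≥0∞)) = ENNReal.ofReal (m ^ n) := by
  rw [gwK_mean, hmean, ENNReal.ofReal_pow (by linarith)]

theorem crude_fin (h : RH R β c1) (p : PMF ℕ) (hp : ∀ t, gwT p t = ENNReal.ofReal (Real.exp (-R t)))
    {m κ b : ℝ} (hκ : 1 < κ) (hm : m = κ * κ) (hmean : gwE p (fun a => (a : ℝ≥0∞)) = ENNReal.ofReal m)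
    (hb : 1 < b) (hbκ : b < κ ^ β) (n : ℕ) :
    ∃ C : ℝ, 0 ≤ C ∧ ∀ t, gwT (gwK p n 1) (m ^ n * t) ≤ ENNReal.ofReal (C * Real.exp (-b * R (κ * t))) := by
  have hm1 : 1 < m := by rw [hm]; nlinarith
  have hκ0 : 0 < κ := by linarith
  induction n with
  | zero =>
    refine h.small (C := 0) (T := 1) (by linarith) hκ0 _ (fun t => gwT_le_one _ _) (fun t ht => ?_)
    show gwT (PMF.pure 1) _ ≤ _
    unfold gwT
    rw [gwE_pure, if_neg (by push_cast; linarith)]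
    exact bot_le
  | succ n ih =>
    obtain ⟨C, hC, hC2⟩ := ih
    obtain ⟨X0, hX0, hU⟩ := h.upper p hp hb hC one_pos
    obtain ⟨T, hT1, hT⟩ := h.lt_mul hκ0 hbκ
    refine h.small (C := 2) (T := max X0 T) (by linarith) hκ0 _ (fun t => gwT_le_one _ _) (fun t ht => ?_)
    have ht1 := (le_max_left _ _).trans ht
    have ht2 := (le_max_right _ _).trans ht
    have ht0 : 0 ≤ t := by linarith
    have h1 := hU (gwK p n 1) (m ^ n) (by positivity) (fun s hs => (hC2 s).trans (ENNReal.ofReal_le_ofReal (by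
      have : R s ≤ R (κ * s) := h.mono (by nlinarith)
      refine mul_le_mul_of_nonneg_left (Real.exp_le_exp.2 ?_) hC
      nlinarith))) (mean_n p hm1 hmean n) (m * t) (by nlinarith)
    rw [gwT_succ, pow_succ, mul_assoc]
    refine h1.trans (ENNReal.ofReal_le_ofReal ?_)
    have h2 := hT (κ * t) (by nlinarith)
    rw [show κ * (κ * t) = m * t by rw [hm]; ring] at h2
    norm_num
    linarith

set_option maxHeartbeats 1600000 in
theorem stepb (h : RH R β c1) (p : PMF ℕ) (hp : ∀ t, gwT p t = ENNReal.ofReal (Real.exp (-R t)))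
    {m A b : ℝ} (hA : 1 < A) (hm : m = A ^ 4) (hmean : gwE p (fun a => (a : ℝ≥0∞)) = ENNReal.ofReal m)
    (hb : 1 < b) :
    ∃ K : ℝ, 0 ≤ K ∧ ∃ n0 : ℕ, ∃ x0 : ℝ, 1 ≤ x0 ∧ ∀ j : ℕ, n0 ≤ j → ∀ x ≥ x0, ∀ k : ℕ,
      (k : ℝ) ≤ m ^ j * (x * (1 + (A ^ 2 - 1) * (1 - (1 / A) ^ j))) →
      gwT (gwPw p k) (m ^ (j + 1) * (x * (1 + (A ^ 2 - 1) * (1 - (1 / A) ^ (j + 1))))) ≤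
        ENNReal.ofReal ((1 + 2 * K) * Real.exp (-b * R (A ^ 2 * x)) * (1 / 2) ^ j) := by
  have hA0 : 0 < A := by linarith
  have hb0 := h.b0
  obtain ⟨K, hK, hld⟩ := h.ldev (b := 1) (θ := 1 / 2) (C := 1) (ν := m) (by norm_num) (by norm_num) zero_le_one (by rw [hm]; positivity)
  set δ := (A ^ 2 - 1) * (1 - 1 / A) with hδ
  have hδ0 : 0 < δ := by
    have h1 : 1 / A < 1 := by rw [div_lt_one hA0]; exact hA
    have h2 : 1 < A ^ 2 := by nlinarith
    rw [hδ]; apply mul_pos <;> linarith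
  have hlA : 0 < Real.log A := Real.log_pos hA
  set M := 4 * Real.log A + 2 + 2 * b * A ^ 2 with hM
  have hM0 : 0 < M := by rw [hM]; positivity
  have hA3 : 1 < A ^ 3 := one_lt_pow₀ hA (by norm_num)
  obtain ⟨n1, hn1⟩ := gw_expo (B := A ^ 3) (c := A ^ 4 * δ) hA3 (by positivity) 1
  obtain ⟨n2, hn2⟩ := gw_expo (B := (A ^ 3) ^ (β / 2)) (c := 1 / 4 * (A ^ 4 * δ) ^ (β / 2)) (Real.one_lt_rpow hA3 (by linarith)) (by positivity) M
  obtain ⟨n3, hn3⟩ := gw_expo (B := A) (c := A ^ 3 * δ) hA (by positivity) M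
  obtain ⟨e, he, he8, T1, hT11, hT1⟩ := h.half
  obtain ⟨T2, hT21, hT2⟩ := h.potter_low (b := β / 2) (by linarith) (by linarith)
  obtain ⟨T3, hT31, hT3⟩ := h.qd one_pos
  obtain ⟨T4, hT41, hT4⟩ := h.expdec (κ := 1) one_pos 1
  obtain ⟨g, hg, T5, hT51, hT5⟩ := h.lowpow
  refine ⟨K, hK, max n1 (max n2 n3), max T1 (max T2 (max T3 (max T4 T5))), hT11.trans (le_max_left _ _), fun j hj x hx k hk => ?_⟩
  have j1 : n1 ≤ j := (le_max_left _ _).trans hj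
  have j2 : n2 ≤ j := ((le_max_left _ _).trans (le_max_right _ _)).trans hj
  have j3 : n3 ≤ j := ((le_max_right _ _).trans (le_max_right _ _)).trans hj
  obtain ⟨x1, hx'⟩ := max_le_iff.1 hx
  obtain ⟨x2, hx'⟩ := max_le_iff.1 hx'
  obtain ⟨x3, hx'⟩ := max_le_iff.1 hx'
  obtain ⟨x4, x5⟩ := max_le_iff.1 hx'
  have hxone : 1 ≤ x := by linarith
  have hx0 : 0 < x := by linarith
  have y1 := hn1 j j1
  have y2 := hn2 j j2
  have y3 := hn3 j j3
  set r := R x with hr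
  have hj0 : (0 : ℝ) ≤ j := by positivity
  have hr1 : 1 ≤ r := (Real.one_le_rpow hxone hg.le).trans (hT5 x x5)
  have hlog : Real.log x ≤ r := by
    have h1 := hT4 x x4
    rw [pow_one] at h1
    have h2 : x ≤ Real.exp r := by
      calc x = (x * Real.exp (-1 * R x)) * Real.exp r := by
            rw [mul_assoc, ← Real.exp_add, ← hr]; simp
        _ ≤ 1 * Real.exp r := by gcongr
        _ = _ := one_mul _
    exact (Real.log_le_iff_le_exp hx0).2 h2
  have hsqr : r ≤ Real.sqrt x := by
    refine (hT1 x x1).trans ?_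
    rw [Real.sqrt_eq_rpow]
    exact Real.rpow_le_rpow_of_exponent_le hxone (by linarith)
  have hA2 : 1 < A ^ 2 := by nlinarith
  have hRκ : R (A ^ 2 * x) ≤ 2 * A ^ 2 * r := by
    have := hT3 x x3 (A ^ 2 * x) (by nlinarith)
    have h2 : R (A ^ 2 * x) * x ≤ (2 * A ^ 2 * r) * x := by rw [hr]; linarith
    exact le_of_mul_le_mul_right h2 hx0
  set u := A ^ 4 * δ * (A ^ 3) ^ j * x with hu
  set N := A ^ 2 * (A ^ 4) ^ j * x with hN
  have hN0 : 0 < N := by rw [hN]; positivity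
  have hN1 : 1 ≤ N := by
    rw [hN]
    have : 1 ≤ (A ^ 4) ^ j := one_le_pow₀ (one_le_pow₀ hA.le)
    have : 1 ≤ A ^ 2 * (A ^ 4) ^ j := one_le_mul_of_one_le_of_one_le hA2.le this
    exact one_le_mul_of_one_le_of_one_le this hxone
  have hyx : 1 ≤ A ^ 4 * δ * (A ^ 3) ^ j := by linarith
  have hux : x ≤ u := by rw [hu]; exact le_mul_of_one_le_left hx0.le hyx
  -- R u
  have hRu : 2 * (M * (j + 1)) * r ≤ R u := by
    have h1 := hT2 x x2 u hux
    have h2 : u / x = A ^ 4 * δ * (A ^ 3) ^ j := by rw [hu]; field_simp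
    rw [h2, Real.mul_rpow (by positivity) (by positivity), ← Real.rpow_pow_comm (by positivity)] at h1
    refine le_trans ?_ h1
    have : 0 ≤ r := by linarith
    calc 2 * (M * (j + 1)) * r ≤ 2 * (1 / 4 * (A ^ 4 * δ) ^ (β / 2) * ((A ^ 3) ^ (β / 2)) ^ j) * r := by gcongr
      _ = _ := by ring
  have hsN : Real.sqrt N = A * (A ^ 2) ^ j * Real.sqrt x := by
    rw [hN, show A ^ 2 * (A ^ 4) ^ j * x = (A * (A ^ 2) ^ j) ^ 2 * x by rw [mul_pow, ← pow_mul, ← pow_mul, ← pow_mul]; ring_nf]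
    rw [Real.sqrt_mul (by positivity), Real.sqrt_sq (by positivity)]
  have hsx : 0 < Real.sqrt x := Real.sqrt_pos.2 hx0
  have huN : M * (j + 1) * r ≤ u / Real.sqrt N := by
    have h1 : u / Real.sqrt N = A ^ 3 * δ * A ^ j * Real.sqrt x := by
      rw [hsN, div_eq_iff (by positivity), hu]
      have := Real.mul_self_sqrt hx0.le
      calc A ^ 4 * δ * (A ^ 3) ^ j * x = A ^ 4 * δ * (A ^ 3) ^ j * (Real.sqrt x * Real.sqrt x) := by rw [this]
        _ = _ := by
          rw [show (A ^ 3) ^ j = A ^ j * (A ^ 2) ^ j by rw [← mul_pow]; ring_nf]; ring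
    rw [h1]
    gcongr
  set P := Real.exp (-b * R (A ^ 2 * x)) * (1 / 2) ^ j with hP
  have hPlow : Real.exp (-b * (2 * A ^ 2 * r) - j) ≤ P := by
    rw [sub_eq_add_neg, Real.exp_add, hP]
    refine mul_le_mul (Real.exp_le_exp.2 ?_) ?_ (Real.exp_pos _).le (Real.exp_pos _).le
    · have := mul_le_mul_of_nonneg_left hRκ (show 0 ≤ b by linarith)
      linarith
    · rw [← mul_neg_one, Real.exp_nat_mul]
      gcongr
      rw [Real.exp_neg, one_div]
      gcongr
      have := Real.add_one_le_exp (1 : ℝ); linarith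
  have t1 : Real.exp (-(u / Real.sqrt N)) ≤ P := by
    refine le_trans (Real.exp_le_exp.2 ?_) hPlow
    have : (2 * b * A ^ 2 * r + j) ≤ M * (j + 1) * r := by
      rw [hM]
      have e1 : 0 ≤ Real.log A * (j + 1) * r := by positivity
      have e2 : 0 ≤ 2 * b * A ^ 2 * j * r := by positivity
      have e5 : 0 ≤ j * (r - 1) := mul_nonneg hj0 (by linarith)
      linarith
    linarith
  have t2 : N * Real.exp (-(1 / 2 * R u)) ≤ P := by
    refine le_trans ?_ hPlow
    rw [← Real.exp_log hN0, ← Real.exp_add]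
    apply Real.exp_le_exp.2
    have hlN : Real.log N = 2 * Real.log A + j * (4 * Real.log A) + Real.log x := by
      rw [hN, Real.log_mul (by positivity) hx0.ne', Real.log_mul (by positivity) (by positivity), Real.log_pow, Real.log_pow, Real.log_pow]
      push_cast; ring
    rw [hlN]
    have : (2 * Real.log A + j * (4 * Real.log A) + r + 2 * b * A ^ 2 * r + j) ≤ M * (j + 1) * r := by
      rw [hM]
      have e1 : 0 ≤ Real.log A * (r - 1) := mul_nonneg hlA.le (by linarith)
      have e3 : 0 ≤ j * (Real.log A * (r - 1)) := mul_nonneg hj0 e1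
      have e4 : 0 ≤ Real.log A * r := by positivity
      have e2 : 0 ≤ 2 * b * A ^ 2 * j * r := by positivity
      have e5 : 0 ≤ j * (r - 1) := mul_nonneg hj0 (by linarith)
      linarith
    linarith
  have t3 : Real.exp (-(1 / 2 * R u)) ≤ P := by
    refine le_trans ?_ t2
    exact le_mul_of_one_le_left (Real.exp_pos _).le hN1
  have hRu0 := h.nonneg u
  have t4 : N * 1 * Real.exp (-1 * R u) ≤ P := by
    refine le_trans ?_ t2
    rw [mul_one]
    gcongr
    linarith
  have hρ : 0 ≤ (1 / A) ^ j := by positivity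
  have hρ1 : (1 / A) ^ j * A ^ j = 1 := by rw [← mul_pow, one_div, inv_mul_cancel₀ hA0.ne', one_pow]
  have hkN : (k : ℝ) ≤ N := by
    refine hk.trans ?_
    rw [hN, hm]
    calc (A ^ 4) ^ j * (x * (1 + (A ^ 2 - 1) * (1 - (1 / A) ^ j))) ≤ (A ^ 4) ^ j * (x * (1 + (A ^ 2 - 1) * (1 - 0))) := by
          have : 0 ≤ A ^ 2 - 1 := by linarith
          gcongr
      _ = _ := by ring
  have hka : m * k + u ≤ m ^ (j + 1) * (x * (1 + (A ^ 2 - 1) * (1 - (1 / A) ^ (j + 1)))) := by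
    have h1 : m * (k : ℝ) ≤ m * (m ^ j * (x * (1 + (A ^ 2 - 1) * (1 - (1 / A) ^ j)))) := by
      have : 0 < m := by rw [hm]; positivity
      gcongr
    have h2 : u = m ^ (j + 1) * (x * δ * (1 / A) ^ j) := by
      rw [hu, hm, pow_succ (A ^ 4) j]
      have : (A ^ 4) ^ j = (A ^ 3) ^ j * A ^ j := by rw [← mul_pow]; ring_nf
      rw [this]
      linear_combination (-(A ^ 4 * δ * (A ^ 3) ^ j * x)) * hρ1
    rw [h2]
    refine (add_le_add_left h1 _).trans (le_of_eq ?_)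
    rw [hδ, pow_succ (1 / A) j, pow_succ m j]
    ring
  have hfin := hld p 1 one_pos (fun t _ => by rw [one_mul, hp]; apply ENNReal.ofReal_le_ofReal; rw [one_mul, neg_one_mul])
    (by rw [one_mul]; exact hmean) N k u _ hN1 hkN (by linarith) hka
  rw [one_mul] at hfin
  refine hfin.trans (ENNReal.ofReal_le_ofReal ?_)
  calc _ ≤ P + K * (P + P) := add_le_add t4 (mul_le_mul_of_nonneg_left (add_le_add t1 t3) hK)
    _ = _ := by rw [hP]; ring

theorem crude (h : RH R β c1) (p : PMF ℕ) (hp : ∀ t, gwT p t = ENNReal.ofReal (Real.exp (-R t)))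
    {m : ℝ} (hm1 : 1 < m) (hmean : gwE p (fun a => (a : ℝ≥0∞)) = ENNReal.ofReal m) :
    ∃ b C : ℝ, 1 < b ∧ 0 ≤ C ∧ ∀ n : ℕ, ∀ t, 0 ≤ t →
      gwT (gwK p n 1) (m ^ n * t) ≤ ENNReal.ofReal (C * Real.exp (-b * R t)) := by
  set A := Real.sqrt (Real.sqrt m) with hAdef
  have hA : 1 < A := by
    rw [hAdef, Real.lt_sqrt (by norm_num), one_pow, Real.lt_sqrt (by norm_num), one_pow]; exact hm1
  have hA0 : 0 < A := by linarith
  have hm : m = A ^ 4 := by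
    rw [show A ^ 4 = (A ^ 2) ^ 2 by ring, hAdef, Real.sq_sqrt (Real.sqrt_nonneg _), Real.sq_sqrt (by linarith)]
  have hA2 : 1 < A ^ 2 := by nlinarith
  obtain ⟨b, hb, hbκ⟩ := exists_between (Real.one_lt_rpow hA2 h.b0)
  obtain ⟨K, hK, n0, x0, hx0, hstep⟩ := h.stepb p hp hA hm hmean hb
  have hfin := h.crude_fin p hp hA2 (show m = A ^ 2 * A ^ 2 by rw [hm]; ring) hmean hb hbκ
  choose Cf hCf0 hCf using hfin
  set D := 1 + 2 * K with hD
  have hD0 : 0 ≤ D := by positivity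
  have hmono : ∀ t : ℝ, 0 ≤ t → R t ≤ R (A ^ 2 * t) := fun t ht => h.mono (by nlinarith)
  -- induction
  have ind : ∀ x ≥ x0, ∀ j : ℕ, n0 ≤ j →
      gwT (gwK p j 1) (m ^ j * (x * (1 + (A ^ 2 - 1) * (1 - (1 / A) ^ j)))) ≤
        ENNReal.ofReal ((Cf n0 + D * (2 - 2 * (1 / 2) ^ j)) * Real.exp (-b * R (A ^ 2 * x))) := by
    intro x hx j hj
    have hx1 : 0 < x := by linarith
    induction j, hj using Nat.le_induction with
    | base =>
      have hρ : (1 / A) ^ n0 ≤ 1 := pow_le_one₀ (by positivity) (by rw [div_le_one hA0]; exact hA.le)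
      have hh : ((1 : ℝ) / 2) ^ n0 ≤ 1 := pow_le_one₀ (by positivity) (by norm_num)
      refine (gwT_anti _ (s := m ^ n0 * x) ?_).trans ((hCf n0 x).trans (ENNReal.ofReal_le_ofReal ?_))
      · have : 0 ≤ (A ^ 2 - 1) * (1 - (1 / A) ^ n0) := mul_nonneg (by linarith) (by linarith)
        gcongr
        nlinarith
      · apply mul_le_mul_of_nonneg_right _ (Real.exp_pos _).le
        have : 0 ≤ D * (2 - 2 * (1 / 2) ^ n0) := mul_nonneg hD0 (by linarith)
        linarith
    | succ j hj ih =>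
      rw [gwT_succ']
      set s := m ^ j * (x * (1 + (A ^ 2 - 1) * (1 - (1 / A) ^ j))) with hs
      set v := D * Real.exp (-b * R (A ^ 2 * x)) * (1 / 2) ^ j with hv
      have hh : ((1 : ℝ) / 2) ^ j ≤ 1 := pow_le_one₀ (by positivity) (by norm_num)
      calc _ ≤ gwE (gwK p j 1) (fun k => (if s < (k : ℝ) then 1 else 0) + ENNReal.ofReal v) := by
            apply gwE_mono
            intro k
            by_cases hk : s < (k : ℝ)
            · rw [if_pos hk]
              exact (gwT_le_one _ _).trans le_self_add
            · rw [if_neg hk, zero_add]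
              exact hstep j hj x hx k (not_lt.1 hk)
        _ = gwT (gwK p j 1) s + ENNReal.ofReal v := by
            rw [gwE_add, gwE_const]; rfl
        _ ≤ ENNReal.ofReal ((Cf n0 + D * (2 - 2 * (1 / 2) ^ j)) * Real.exp (-b * R (A ^ 2 * x))) + ENNReal.ofReal v := by gcongr
        _ = _ := by
            rw [← ENNReal.ofReal_add]
            · congr 1
              rw [hv, pow_succ]; ring
            · have : 0 ≤ D * (2 - 2 * (1 / 2) ^ j) := mul_nonneg hD0 (by linarith)
              have := hCf0 n0
              positivity
            · positivity
  refine ⟨b, ∑ i ∈ Finset.range (n0 + 1), Cf i + (Cf n0 + 2 * D) + Real.exp (b * R (A ^ 2 * x0)), hb, ?_, fun n t ht => ?_⟩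
  · have : 0 ≤ ∑ i ∈ Finset.range (n0 + 1), Cf i := Finset.sum_nonneg fun i _ => hCf0 i
    have := hCf0 n0
    positivity
  have hs0 : 0 ≤ ∑ i ∈ Finset.range (n0 + 1), Cf i := Finset.sum_nonneg fun i _ => hCf0 i
  have hc0 := hCf0 n0
  have he0 := Real.exp_pos (b * R (A ^ 2 * x0))
  rcases le_or_gt n n0 with hn | hn
  · refine (hCf n t).trans (ENNReal.ofReal_le_ofReal ?_)
    apply mul_le_mul
    · have := Finset.single_le_sum (f := Cf) (fun i _ => hCf0 i) (Finset.mem_range.2 (Nat.lt_succ_of_le hn))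
      linarith
    · apply Real.exp_le_exp.2
      have := hmono t ht
      nlinarith
    · positivity
    · positivity
  · rcases le_or_gt (A ^ 2 * x0) t with h1 | h1
    · have hx : x0 ≤ t / A ^ 2 := by rw [le_div_iff₀ (by positivity)]; linarith
      have e1 : A ^ 2 * (t / A ^ 2) = t := by field_simp
      have h2 := ind (t / A ^ 2) hx n hn.le
      rw [e1] at h2
      refine (gwT_anti _ ?_).trans (h2.trans (ENNReal.ofReal_le_ofReal ?_))
      · have hρ : 0 ≤ (1 / A) ^ n := by positivity
        have h5 : 1 + (A ^ 2 - 1) * (1 - (1 / A) ^ n) ≤ A ^ 2 := by nlinarith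
        have h6 : t / A ^ 2 * (1 + (A ^ 2 - 1) * (1 - (1 / A) ^ n)) ≤ t := by
          calc _ ≤ t / A ^ 2 * A ^ 2 := by gcongr
            _ = t := by field_simp
        gcongr
      · apply mul_le_mul_of_nonneg_right _ (Real.exp_pos _).le
        have : 0 ≤ D * ((1 / 2) ^ n) := by positivity
        linarith
    · refine (gwT_le_one _ _).trans ?_
      rw [← ENNReal.ofReal_one]
      apply ENNReal.ofReal_le_ofReal
      have h2 : R t ≤ R (A ^ 2 * x0) := h.mono h1.le
      calc (1 : ℝ) ≤ Real.exp (b * R (A ^ 2 * x0)) * Real.exp (-b * R t) := by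
            rw [← Real.exp_add]
            apply Real.one_le_exp
            nlinarith
        _ ≤ _ := by
            apply mul_le_mul_of_nonneg_right _ (Real.exp_pos _).le
            linarith

end RH

open MeasureTheory Filter ProbabilityTheory

open scoped ENNReal

theorem gw_split {Ω : Type*} [MeasurableSpace Ω] (μ : Measure Ω) {Y : Ω → ℕ} (hY : Measurable Y) {s : Set Ω} (hs : MeasurableSet s) :
    μ s = ∑' k, μ (Y ⁻¹' {k} ∩ s) := by
  have : s = ⋃ k, (Y ⁻¹' {k} ∩ s) := by
    ext ω; simp
  conv_lhs => rw [this]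
  apply measure_iUnion
  · intro i j hij
    apply Set.disjoint_left.2
    rintro ω ⟨h1, _⟩ ⟨h2, _⟩
    simp only [Set.mem_preimage, Set.mem_singleton_iff] at h1 h2
    exact hij (h1.symm.trans h2)
  · intro k
    exact (hY (measurableSet_singleton k)).inter hs

theorem gw_mix {Ω : Type*} [MeasurableSpace Ω] (μ : Measure Ω) {Y : Ω → ℕ} (hY : Measurable Y)
    {G : ℕ → Ω → ℕ} (hG : ∀ k, Measurable (G k)) (hGY : Measurable fun ω => G (Y ω) ω)
    (hi : ∀ k, IndepFun Y (G k) μ) {q : PMF ℕ} {r : ℕ → PMF ℕ}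
    (hq : ∀ k, μ (Y ⁻¹' {k}) = q k) (hr : ∀ k c, μ (G k ⁻¹' {c}) = r k c) (c : ℕ) :
    μ ((fun ω => G (Y ω) ω) ⁻¹' {c}) = (q.bind r) c := by
  rw [gw_split μ hY (hGY (measurableSet_singleton c)), PMF.bind_apply]
  congr 1; ext k
  rw [← hq, ← hr, ← (hi k).measure_inter_preimage_eq_mul _ _ (measurableSet_singleton k) (measurableSet_singleton c)]
  congr 1
  ext ω
  simp only [Set.mem_inter_iff, Set.mem_preimage, Set.mem_singleton_iff]
  constructor
  · rintro ⟨h1, h2⟩; rw [h1] at h2; exact ⟨h1, h2⟩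
  · rintro ⟨h1, h2⟩; refine ⟨h1, ?_⟩; rw [h1]; exact h2

theorem gw_tail {Ω : Type*} [MeasurableSpace Ω] (μ : Measure Ω) {Y : Ω → ℕ} (hY : Measurable Y)
    {q : PMF ℕ} (hq : ∀ k, μ (Y ⁻¹' {k}) = q k) (t : ℝ) :
    μ {ω | t < (Y ω : ℝ)} = gwT q t := by
  have hs : MeasurableSet {ω | t < (Y ω : ℝ)} := hY (MeasurableSet.of_discrete (s := {k : ℕ | t < (k : ℝ)}))
  rw [gw_split μ hY hs]
  unfold gwT gwE
  congr 1; ext k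
  rw [← hq]
  show _ = μ (Y ⁻¹' {k}) * (if t < (k : ℝ) then 1 else 0)
  split_ifs with h
  · rw [mul_one]; congr 1; ext ω
    simp only [Set.mem_inter_iff, Set.mem_preimage, Set.mem_singleton_iff, Set.mem_setOf_eq]
    constructor
    · exact fun h => h.1
    · intro h1; rw [h1]; exact ⟨rfl, h⟩
  · rw [mul_zero]
    convert measure_empty (μ := μ)
    ext ω
    simp only [Set.mem_inter_iff, Set.mem_preimage, Set.mem_singleton_iff, Set.mem_setOf_eq, Set.mem_empty_iff_false, iff_false]
    rintro ⟨h1, h2⟩; rw [h1] at h2; exact h h2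

theorem gw_msum {Ω : Type*} {m' : MeasurableSpace Ω} {Y : Ω → ℕ} (hY : Measurable Y) {f : ℕ → Ω → ℕ} (hf : ∀ i, Measurable (f i)) :
    Measurable fun ω => ∑ i ∈ Finset.range (Y ω), f i ω := by
  have h1 : Measurable (fun z : Ω × ℕ => ∑ i ∈ Finset.range z.2, f i z.1) :=
    measurable_from_prod_countable_left fun k => Finset.measurable_sum (Finset.range k) fun i _ => hf i
  exact h1.comp (measurable_id.prodMk hY)

section
variable {Ω : Type*} [mΩ : MeasurableSpace Ω] (μ : Measure Ω) [IsProbabilityMeasure μ]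
    (ξ : ℕ → ℕ → Ω → ℕ)

theorem gw_indep (hmeas : ∀ n i, Measurable (ξ n i))
    (hindep : iIndepFun (fun p : ℕ × ℕ => ξ p.1 p.2) μ) {S T : Set (ℕ × ℕ)} (hST : Disjoint S T) {X Y : Ω → ℕ}
    (hX : Measurable[⨆ p ∈ S, MeasurableSpace.comap (ξ p.1 p.2) ⊤] X)
    (hY : Measurable[⨆ p ∈ T, MeasurableSpace.comap (ξ p.1 p.2) ⊤] Y) : IndepFun X Y μ := by
  have h1 := (iIndepFun_iff_iIndep _ _ _).1 hindep
  have h2 := indep_iSup_of_disjoint (fun p => (hmeas p.1 p.2).comap_le) h1 hST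
  rw [IndepFun_iff_Indep]
  exact indep_of_indep_of_le_left (indep_of_indep_of_le_right h2 hY.comap_le) hX.comap_le

theorem gw_gen {S : Set (ℕ × ℕ)} {n i : ℕ} (h : (n, i) ∈ S) :
    Measurable[⨆ p ∈ S, MeasurableSpace.comap (ξ p.1 p.2) ⊤] (ξ n i) := by
  apply measurable_iff_comap_le.2
  exact le_iSup₂_of_le (n, i) h le_rfl

theorem gw_law_sum (hmeas : ∀ n i, Measurable (ξ n i))
    (hindep : iIndepFun (fun p : ℕ × ℕ => ξ p.1 p.2) μ) {p : PMF ℕ}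
    (hp : ∀ n i k, μ (ξ n i ⁻¹' {k}) = p k) (n k c : ℕ) :
    μ ((fun ω => ∑ i ∈ Finset.range k, ξ n i ω) ⁻¹' {c}) = gwPw p k c := by
  induction k generalizing c with
  | zero =>
    simp only [Finset.range_zero, Finset.sum_empty, gwPw, PMF.pure_apply]
    split_ifs with h
    · subst h; simp
    · have : ((fun _ : Ω => (0 : ℕ)) ⁻¹' {c}) = ∅ := by
        ext ω; simp; exact fun h' => h h'.symm
      rw [this, measure_empty]
  | succ k ih =>
    have hS : Measurable (fun ω => ∑ i ∈ Finset.range k, ξ n i ω) := Finset.measurable_sum _ fun i _ => hmeas n i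
    have hpt : (fun ω => ∑ i ∈ Finset.range (k + 1), ξ n i ω) = fun ω => (fun (a : ℕ) ω => a + ∑ i ∈ Finset.range k, ξ n i ω) (ξ n k ω) ω := by
      ext ω; rw [Finset.sum_range_succ]; ring
    rw [hpt, gwPw]
    have hind : IndepFun (ξ n k) (fun ω => ∑ i ∈ Finset.range k, ξ n i ω) μ := by
      refine gw_indep μ ξ hmeas hindep (S := {(n, k)}) (T := {p | p.2 < k}) ?_ (gw_gen ξ rfl) ?_
      · rw [Set.disjoint_singleton_left]; simp
      · exact Finset.measurable_sum _ fun i hi => gw_gen ξ (by simpa using hi)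
    refine gw_mix μ (hmeas n k) (G := fun (a : ℕ) ω => a + ∑ i ∈ Finset.range k, ξ n i ω) (fun a => hS.const_add a) ((hmeas n k).add hS) (fun a => hind.comp measurable_id (measurable_const_add a)) (hp n k) (fun a c => ?_) c
    refine gw_mix μ hS (G := fun (b : ℕ) (_ : Ω) => a + b) (fun b => measurable_const) (hS.const_add a) (fun b => indepFun_const_right _ _) ih (fun b c => ?_) c
    rw [PMF.pure_apply]
    split_ifs with h
    · subst h; simp
    · have : ((fun _ : Ω => a + b) ⁻¹' {c}) = ∅ := by
        ext ω; simp; exact fun h' => h h'.symm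
      rw [this, measure_empty]

theorem gw_law_Z (hmeas : ∀ n i, Measurable (ξ n i))
    (hindep : iIndepFun (fun p : ℕ × ℕ => ξ p.1 p.2) μ) {p : PMF ℕ}
    (hp : ∀ n i k, μ (ξ n i ⁻¹' {k}) = p k) (Z : ℕ → Ω → ℕ)
    (hZ0 : ∀ ω, Z 0 ω = 1)
    (hZrec : ∀ n ω, Z (n + 1) ω = ∑ i ∈ Finset.range (Z n ω), ξ n i ω) (n : ℕ) :
    Measurable (Z n) ∧ ∀ c, μ (Z n ⁻¹' {c}) = gwK p n 1 c := by
  have hZ0' : Z 0 = fun _ => 1 := funext hZ0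
  have hZ' : ∀ n, Z (n + 1) = fun ω => ∑ i ∈ Finset.range (Z n ω), ξ n i ω := fun n => funext (hZrec n)
  have hZm : ∀ n, Measurable (Z n) := by
    intro n
    induction n with
    | zero => rw [hZ0']; exact measurable_const
    | succ n ih => rw [hZ']; exact gw_msum ih (hmeas n)
  have hZg : ∀ n, Measurable[⨆ p ∈ {p : ℕ × ℕ | p.1 < n}, MeasurableSpace.comap (ξ p.1 p.2) ⊤] (Z n) := by
    intro n
    induction n with
    | zero => rw [hZ0']; exact measurable_const
    | succ n ih =>
      rw [hZ']
      refine gw_msum (m' := ⨆ p ∈ {p : ℕ × ℕ | p.1 < n + 1}, MeasurableSpace.comap (ξ p.1 p.2) ⊤) ?_ ?_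
      · refine ih.mono ?_ le_rfl
        exact biSup_mono fun p hp => Nat.lt_succ_of_lt hp
      · exact fun i => gw_gen ξ (Nat.lt_succ_self n)
  refine ⟨hZm n, ?_⟩
  induction n with
  | zero =>
    intro c
    rw [hZ0']
    simp only [gwK, PMF.pure_apply]
    split_ifs with h
    · subst h; simp
    · have : ((fun _ : Ω => 1) ⁻¹' {c}) = ∅ := by
        ext ω; simp; exact fun h' => h h'.symm
      rw [this, measure_empty]
  | succ n ih =>
    intro c
    have hm1 := hZm (n + 1)
    rw [hZ'] at hm1 ⊢
    refine gw_mix μ (hZm n) (G := fun k ω => ∑ i ∈ Finset.range k, ξ n i ω) (fun k => Finset.measurable_sum _ fun i _ => hmeas n i) hm1 (fun k => ?_) ih (gw_law_sum μ ξ hmeas hindep hp n) c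
    refine gw_indep μ ξ hmeas hindep (S := {p | p.1 < n}) (T := {p | p.1 = n}) ?_ (hZg n) ?_
    · rw [Set.disjoint_left]; intro p h1 h2; simp only [Set.mem_setOf_eq] at h1 h2; omega
    · exact Finset.measurable_sum _ fun i hi => gw_gen ξ rfl
end

theorem gw_uniform {R : ℝ → ℝ} {β c1 : ℝ} (h : RH R β c1) (p : PMF ℕ) (hp : ∀ t, gwT p t = ENNReal.ofReal (Real.exp (-R t)))
    {m : ℝ} (hm1 : 1 < m) (hmean : gwE p (fun a => (a : ℝ≥0∞)) = ENNReal.ofReal m) {ε : ℝ} (hε : 0 < ε) (hε1 : ε < 1) :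
    ∃ x0 : ℝ, 1 ≤ x0 ∧ ∀ x ≥ x0, ∀ n : ℕ, 1 ≤ n →
      ENNReal.ofReal ((1 - ε) * Real.exp (-R (m * x))) ≤ gwT (gwK p n 1) (m ^ n * x) ∧
      gwT (gwK p n 1) (m ^ n * x) ≤ ENNReal.ofReal ((1 + ε) * Real.exp (-R (m * x))) := by
  obtain ⟨b, C, hb, hC, hcr⟩ := h.crude p hp hm1 hmean
  obtain ⟨X1, hX1, hU⟩ := h.upper p hp hb hC hε
  obtain ⟨X2, hX2, hL⟩ := h.lower p hp hb hC hε hε1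
  refine ⟨max X1 X2, hX1.trans (le_max_left _ _), fun x hx n hn => ?_⟩
  obtain ⟨n, rfl⟩ : ∃ k, n = k + 1 := ⟨n - 1, by omega⟩
  obtain ⟨hx1, hx2⟩ := max_le_iff.1 hx
  have hc : 0 < m ^ n := by positivity
  rw [RH.gwT_succ, pow_succ, mul_assoc]
  exact ⟨hL _ _ hc (hcr n) (RH.mean_n p hm1 hmean n) (m * x) (by nlinarith),
    hU _ _ hc (hcr n) (RH.mean_n p hm1 hmean n) (m * x) (by nlinarith)⟩

theorem gw_ratio {P : ℝ≥0∞} {F ε : ℝ} (hF : 0 < F) (hε : 0 < ε) (hε1 : ε < 1) (h1 : ENNReal.ofReal ((1 - ε) * F) ≤ P)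
    (h2 : P ≤ ENNReal.ofReal ((1 + ε) * F)) : |P.toReal / F - 1| ≤ ε := by
  have hP : P ≠ ∞ := ne_top_of_le_ne_top ENNReal.ofReal_ne_top h2
  have h3 := (ENNReal.ofReal_le_iff_le_toReal hP).1 h1
  have h4 := ENNReal.toReal_le_of_le_ofReal (by positivity) h2
  rw [abs_le]
  constructor
  · have : 1 - ε ≤ P.toReal / F := by rw [le_div_iff₀ hF]; exact h3
    linarith
  · have : P.toReal / F ≤ 1 + ε := by rw [div_le_iff₀ hF]; exact h4
    linarith

theorem gw_lim_up {Ω : Type*} [MeasurableSpace Ω] (μ : Measure Ω) {W : ℕ → Ω → ℝ} {Wlim : Ω → ℝ}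
    (hWlim : ∀ᵐ ω ∂μ, Tendsto (fun n => W n ω) atTop (nhds (Wlim ω))) {x : ℝ} {v : ℝ≥0∞}
    (hv : ∀ n, 1 ≤ n → μ {ω | x < W n ω} ≤ v) : μ {ω | x < Wlim ω} ≤ v := by
  set B : ℕ → Set Ω := fun N => {ω | ∀ n ≥ N, x < W n ω} with hB
  have h1 : {ω | x < Wlim ω} ≤ᵐ[μ] ⋃ N, B N := by
    filter_upwards [hWlim] with ω hω hx
    have hx' : x < Wlim ω := hx
    obtain ⟨N, hN⟩ := eventually_atTop.1 (hω.eventually (lt_mem_nhds hx'))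
    exact Set.mem_iUnion.2 ⟨N, hN⟩
  refine (measure_mono_ae h1).trans ?_
  have hmono : Monotone B := fun N M hNM ω hω n hn => hω n (hNM.trans hn)
  rw [hmono.measure_iUnion]
  refine iSup_le fun N => ?_
  refine (measure_mono ?_).trans (hv (N + 1) (by omega))
  exact fun ω hω => hω (N + 1) (by omega)

theorem gw_lim_low {Ω : Type*} [MeasurableSpace Ω] (μ : Measure Ω) [IsProbabilityMeasure μ] {W : ℕ → Ω → ℝ} {Wlim : Ω → ℝ}
    (hWm : ∀ n, Measurable (W n))
    (hWlim : ∀ᵐ ω ∂μ, Tendsto (fun n => W n ω) atTop (nhds (Wlim ω))) {x x' : ℝ} (hxx : x < x') {v : ℝ≥0∞}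
    (hv : ∀ n, 1 ≤ n → v ≤ μ {ω | x' < W n ω}) : v ≤ μ {ω | x < Wlim ω} := by
  set B : ℕ → Set Ω := fun N => ⋃ n ≥ N, {ω | x' < W n ω} with hB
  have h1 : (⋂ N, B N : Set Ω) ≤ᵐ[μ] {ω | x < Wlim ω} := by
    filter_upwards [hWlim] with ω hω hx
    have hx' : ω ∈ ⋂ N, B N := hx
    show x < Wlim ω
    refine hxx.trans_le ?_
    by_contra hlt
    obtain ⟨N, hN⟩ := eventually_atTop.1 (hω.eventually (gt_mem_nhds (not_le.1 hlt)))
    have h2 := Set.mem_iInter.1 hx' N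
    simp only [hB, Set.mem_iUnion, Set.mem_setOf_eq] at h2
    obtain ⟨n, hn, h3⟩ := h2
    exact lt_asymm h3 (hN n hn)
  refine le_trans ?_ (measure_mono_ae h1)
  have hanti : Antitone B := fun N M hNM ω hω => by
    simp only [hB, Set.mem_iUnion] at hω ⊢
    obtain ⟨n, hn, h3⟩ := hω
    exact ⟨n, hNM.trans hn, h3⟩
  rw [hanti.measure_iInter (fun N => (MeasurableSet.iUnion fun n => MeasurableSet.iUnion fun _ => measurableSet_lt measurable_const (hWm n)).nullMeasurableSet) ⟨0, measure_ne_top _ _⟩]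
  refine le_iInf fun N => (hv (N + 1) (by omega)).trans (measure_mono fun ω hω => ?_)
  simp only [hB, Set.mem_iUnion]
  exact ⟨N + 1, by omega, hω⟩
theorem gw_weibull_beta_lt_half_asymptotics
    {Ω : Type*} [MeasurableSpace Ω] (μ : Measure Ω) [IsProbabilityMeasure μ]
    (ξ : ℕ → ℕ → Ω → ℕ)
    (hmeas : ∀ n i, Measurable (ξ n i))
    (hindep : iIndepFun
      (fun p : ℕ × ℕ => ξ p.1 p.2) μ)
    (hident : ∀ n i, Measure.map (ξ n i) μ = Measure.map (ξ 0 0) μ)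
    (hint : Integrable (fun ω => (ξ 0 0 ω : ℝ)) μ)
    (m : ℝ) (hm : m = ∫ ω, (ξ 0 0 ω : ℝ) ∂μ) (hm1 : 1 < m)
    (Z : ℕ → Ω → ℕ)
    (hZ0 : ∀ ω, Z 0 ω = 1)
    (hZrec : ∀ n ω, Z (n + 1) ω = ∑ i ∈ Finset.range (Z n ω), ξ n i ω)
    (W : ℕ → Ω → ℝ) (hW : ∀ n ω, W n ω = (Z n ω : ℝ) / m ^ n)
    (Fbar : ℝ → ℝ) (hFbar : ∀ x, Fbar x = (μ {ω | x < (ξ 0 0 ω : ℝ)}).toReal)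
    -- Weibull-type tail: `F̄(x) = exp(-R(x))` with `R` regularly varying of index `β`
    (R : ℝ → ℝ) (hR : ∀ x, Fbar x = Real.exp (-R x))
    (β : ℝ) (hβ0 : 0 < β)
    (hRV : ∀ lam > (0 : ℝ),
      Tendsto (fun x => R (lam * x) / R x) atTop (nhds (lam ^ β)))
    -- `F` is strong subexponential
    (hSstar : Tendsto
      (fun x => (∫ y in (0:ℝ)..x, Fbar (x - y) * Fbar y) / (2 * m * Fbar x))
      atTop (nhds 1))
    (hβ1 : β < 1)
    (Wlim : Ω → ℝ)
    (hWlim : ∀ᵐ ω ∂μ, Tendsto (fun n => W n ω) atTop (nhds (Wlim ω)))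
    (hβhalf : β < 1 / 2)
    (hincr : ∃ c₁ : ℝ, ∀ k : ℕ, 1 ≤ k →
      R k - R ((k : ℝ) - 1) ≤ c₁ * R k / k) :
    (∀ ε > (0 : ℝ), ∃ x₀ : ℝ, ∀ x ≥ x₀, ∀ n : ℕ, 1 ≤ n →
        |(μ {ω | x < W n ω}).toReal / Fbar (m * x) - 1| < ε) ∧
    Tendsto (fun x : ℝ => (μ {ω | x < Wlim ω}).toReal / Fbar (m * x))
      atTop (nhds 1) := by
  have hprob : IsProbabilityMeasure (Measure.map (ξ 0 0) μ) := Measure.isProbabilityMeasure_map (hmeas 0 0).aemeasurable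
  set p : PMF ℕ := (Measure.map (ξ 0 0) μ).toPMF with hpdef
  have hpk : ∀ n i k, μ (ξ n i ⁻¹' {k}) = p k := by
    intro n i k
    rw [hpdef, Measure.toPMF_apply, ← hident n i, Measure.map_apply (hmeas n i) (measurableSet_singleton k)]
  have htail : ∀ t, μ {ω | t < (ξ 0 0 ω : ℝ)} = gwT p t := gw_tail μ (hmeas 0 0) (hpk 0 0)
  have hp : ∀ t, gwT p t = ENNReal.ofReal (Real.exp (-R t)) := by
    intro t
    rw [← hR, hFbar, ENNReal.ofReal_toReal (measure_ne_top _ _), htail]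
  have hmean : gwE p (fun a => (a : ℝ≥0∞)) = ENNReal.ofReal m := by
    rw [hm, ofReal_integral_eq_lintegral_ofReal hint (Eventually.of_forall fun ω => by positivity)]
    simp only [ENNReal.ofReal_natCast]
    rw [← lintegral_map (f := fun a : ℕ => (a : ℝ≥0∞)) (measurable_of_countable _) (hmeas 0 0), lintegral_countable']
    unfold gwE
    congr 1; ext a
    rw [hpdef, Measure.toPMF_apply, mul_comm]
  have hFle : ∀ x, Fbar x ≤ 1 := fun x => by
    rw [hFbar]; exact ENNReal.toReal_le_of_le_ofReal zero_le_one (by simpa using prob_le_one)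
  have hmono : Monotone R := by
    intro x y hxy
    have h1 : Fbar y ≤ Fbar x := by
      rw [hFbar, hFbar]
      refine ENNReal.toReal_mono (measure_ne_top _ _) (measure_mono fun ω hω => ?_)
      exact lt_of_le_of_lt hxy hω
    rw [hR, hR, Real.exp_le_exp] at h1
    linarith
  have hnonneg : ∀ x, 0 ≤ R x := fun x => by
    have := hFle x
    rw [hR, Real.exp_le_one_iff] at this
    linarith
  obtain ⟨c₁, hc₁⟩ := hincr
  have hRH : RH R β |c₁| := by
    refine ⟨hmono, hnonneg, ?_, hβ0, hβhalf, hRV, abs_nonneg _, ?_⟩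
    · intro x hx
      have h1 : Fbar x = Fbar ((⌊x⌋₊ : ℕ) : ℝ) := by
        rw [hFbar, hFbar]
        congr 2
        ext ω
        simp only [Set.mem_setOf_eq, Nat.cast_lt]
        exact (Nat.floor_lt hx).symm
      rw [hR, hR, Real.exp_eq_exp] at h1
      linarith
    · intro k hk
      refine (hc₁ k hk).trans ?_
      have := hnonneg k
      gcongr
      exact le_abs_self _
  have hm0 : 0 < m := by linarith
  have hZ := gw_law_Z μ ξ hmeas hindep hpk Z hZ0 hZrec
  have hWt : ∀ n x, μ {ω | x < W n ω} = gwT (gwK p n 1) (m ^ n * x) := by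
    intro n x
    rw [← gw_tail μ (hZ n).1 (hZ n).2]
    congr 1; ext ω
    simp only [Set.mem_setOf_eq]
    rw [hW, lt_div_iff₀ (by positivity), mul_comm]
  have hWm : ∀ n, Measurable (W n) := by
    intro n
    have : W n = fun ω => (Z n ω : ℝ) / m ^ n := funext (hW n)
    rw [this]
    exact ((measurable_of_countable (fun k : ℕ => (k : ℝ))).comp (hZ n).1).div_const _
  have huni : ∀ ε : ℝ, 0 < ε → ε < 1 → ∃ x0 : ℝ, 1 ≤ x0 ∧ ∀ x ≥ x0, ∀ n : ℕ, 1 ≤ n →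
      ENNReal.ofReal ((1 - ε) * Fbar (m * x)) ≤ μ {ω | x < W n ω} ∧
      μ {ω | x < W n ω} ≤ ENNReal.ofReal ((1 + ε) * Fbar (m * x)) := by
    intro ε hε hε1
    obtain ⟨x0, hx0, hh⟩ := gw_uniform hRH p hp hm1 hmean hε hε1
    refine ⟨x0, hx0, fun x hx n hn => ?_⟩
    rw [hWt, hR]
    exact hh x hx n hn
  have hFpos : ∀ x, 0 < Fbar x := fun x => by rw [hR]; exact Real.exp_pos _
  constructor
  · intro ε hε
    have hε' : 0 < min (ε / 2) (1 / 2) := by positivity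
    obtain ⟨x0, hx0, hh⟩ := huni (min (ε / 2) (1 / 2)) hε' ((min_le_right _ _).trans_lt (by norm_num))
    refine ⟨x0, fun x hx n hn => ?_⟩
    refine (gw_ratio (hFpos _) hε' ((min_le_right _ _).trans_lt (by norm_num)) (hh x hx n hn).1 (hh x hx n hn).2).trans_lt ?_
    exact (min_le_left _ _).trans_lt (by linarith)
  · rw [Metric.tendsto_atTop]
    intro ε hε
    have hε' : 0 < min (ε / 2) (1 / 2) := by positivity
    have hε'' : min (ε / 2) (1 / 2) < 1 := (min_le_right _ _).trans_lt (by norm_num)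
    obtain ⟨x0, hx0, hh⟩ := huni (min (ε / 2) (1 / 2)) hε' hε''
    refine ⟨x0, fun x hx => ?_⟩
    rw [Real.dist_eq]
    have hxpos : 0 < x := by linarith
    have hmx : 0 ≤ m * x := by positivity
    refine (gw_ratio (hFpos _) hε' hε'' ?_ (gw_lim_up μ hWlim fun n hn => (hh x hx n hn).2)).trans_lt ((min_le_left _ _).trans_lt (by linarith))
    have hfl := Nat.lt_floor_add_one (m * x)
    obtain ⟨y, hy1, hy2⟩ := exists_between hfl
    have hxy : x < y / m := by rw [lt_div_iff₀ hm0]; linarith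
    have hey : m * (y / m) = y := by field_simp
    have hF : Fbar y = Fbar (m * x) := by
      rw [hR, hR, hRH.floor y (by linarith), hRH.floor (m * x) hmx]
      have : ⌊y⌋₊ = ⌊m * x⌋₊ := by
        rw [Nat.floor_eq_iff (by linarith)]
        exact ⟨(Nat.floor_le hmx).trans hy1.le, hy2⟩
      rw [this]
    refine gw_lim_low μ hWm hWlim hxy fun n hn => ?_
    have := (hh (y / m) (by linarith) n hn).1
    rwa [hey, hF] at this
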